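/- Let s ≥ 0 be a real number and let (X, T) be a dynamical system with a metric d on X. Suppose there exist sequences of natural numbers (N_n), (M_n) and continuous maps ψ_n : [0,1]^{M_n} → X such that N_n → +∞, M_n/N_n → s as n → ∞, and ‖x − y‖_∞ ≤ d_{N_n}(ψ_n(x), ψ_n(y)) for all x, y ∈ [0,1]^{M_n}. Then for every dynamical system (Y, S) and every equivariant continuous map π : (X, T) → (Y, S), the lower conditional metric mean dimension satisfies lower-mdim_M(π, T, d) ≥ s − 2·mdim(Y, S). -/

import Mathlib

open Filter Topology
open scoped ENNReal NNReal

noncomputable section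

/-- Diameter (in `ℝ≥0∞`) of a set with respect to a distance function `ρ`. -/
def setEDiam {X : Type*} (ρ : X → X → ℝ) (E : Set X) : ℝ≥0∞ :=
  ⨆ x ∈ E, ⨆ y ∈ E, ENNReal.ofReal (ρ x y)

/-- Openness with respect to a distance function `ρ`. -/
def ROpen {X : Type*} (ρ : X → X → ℝ) (U : Set X) : Prop :=
  ∀ x ∈ U, ∃ δ > 0, ∀ y, ρ x y < δ → y ∈ U

/-- `#(E, ρ, ε)`: the minimal number `n` of `ρ`-open sets of `ρ`-diameter `< ε` covering `E`
(`0` when `E = ∅`, since the empty family covers it). -/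
def covNum {X : Type*} (ρ : X → X → ℝ) (ε : ℝ) (E : Set X) : ℕ :=
  sInf {n : ℕ | ∃ U : Fin n → Set X, (∀ i, ROpen ρ (U i)) ∧
    (∀ i, setEDiam ρ (U i) < ENNReal.ofReal ε) ∧ E ⊆ ⋃ i, U i}

/-- The dynamical metric `d_N(x,y) = max_{0 ≤ n < N} d(Tⁿx, Tⁿy)`. -/
def dynDist {X : Type*} (T : X → X) (d : X → X → ℝ) (N : ℕ) (x y : X) : ℝ :=
  sSup {r : ℝ | ∃ n, n < N ∧ r = d (T^[n] x) (T^[n] y)}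

/-- `sup_{y ∈ Y} log #(π⁻¹(y), ρ, ε)`. -/
def supLogCov {X Y : Type*} (π : X → Y) (ρ : X → X → ℝ) (ε : ℝ) : ℝ :=
  ⨆ y : Y, Real.log (covNum ρ ε (π ⁻¹' {y}) : ℝ)

/-- `sup_{y ∈ Y} log #(π⁻¹(B_δ(y, ρY)), ρX, ε)` where `B_δ` is the closed `δ`-ball. -/
def supLogCovBall {X Y : Type*} (π : X → Y) (ρX : X → X → ℝ) (ρY : Y → Y → ℝ)
    (ε δ : ℝ) : ℝ :=
  ⨆ y : Y, Real.log (covNum ρX ε (π ⁻¹' {x | ρY x y ≤ δ}) : ℝ)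

/-- Topological conditional entropy
`h_top(π, T) = lim_{ε→0} lim_{N→∞} (sup_y log #(π⁻¹(y), d_N, ε))/N`, as an extended real. -/
def condEntropy {X Y : Type*} (π : X → Y) (T : X → X) (d : X → X → ℝ) : EReal :=
  Filter.limsup (fun ε : ℝ => Filter.liminf
      (fun N : ℕ => ((supLogCov π (dynDist T d N) ε / N : ℝ) : EReal)) Filter.atTop)
    (𝓝[>] (0 : ℝ))

/-- `lim_{N→∞} (sup_y log #(π⁻¹(y), d_N, ε))/(N log(1/ε))` (the limit exists by
subadditivity; it is realized here as a liminf). -/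
def condMdimRate {X Y : Type*} (π : X → Y) (T : X → X) (d : X → X → ℝ) (ε : ℝ) : EReal :=
  Filter.liminf (fun N : ℕ =>
    ((supLogCov π (dynDist T d N) ε / (N * Real.log (1 / ε)) : ℝ) : EReal)) Filter.atTop

/-- Lower conditional metric mean dimension of `π : (X,T,d) → Y`. -/
def lowerCondMdimM {X Y : Type*} (π : X → Y) (T : X → X) (d : X → X → ℝ) : EReal :=
  Filter.liminf (fun ε : ℝ => condMdimRate π T d ε) (𝓝[>] (0 : ℝ))

/-- Upper conditional metric mean dimension of `π : (X,T,d) → Y`. -/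
def upperCondMdimM {X Y : Type*} (π : X → Y) (T : X → X) (d : X → X → ℝ) : EReal :=
  Filter.limsup (fun ε : ℝ => condMdimRate π T d ε) (𝓝[>] (0 : ℝ))

/-- `lim_{N→∞} log #(X, d_N, ε)/(N log(1/ε))`. -/
def mdimMRate {X : Type*} (T : X → X) (d : X → X → ℝ) (ε : ℝ) : EReal :=
  Filter.liminf (fun N : ℕ =>
    ((Real.log (covNum (dynDist T d N) ε (Set.univ : Set X) : ℝ) /
      (N * Real.log (1 / ε)) : ℝ) : EReal)) Filter.atTop

/-- Lower metric mean dimension of `(X, T, d)`. -/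
def lowerMdimM {X : Type*} (T : X → X) (d : X → X → ℝ) : EReal :=
  Filter.liminf (fun ε : ℝ => mdimMRate T d ε) (𝓝[>] (0 : ℝ))

/-- Upper metric mean dimension of `(X, T, d)`. -/
def upperMdimM {X : Type*} (T : X → X) (d : X → X → ℝ) : EReal :=
  Filter.limsup (fun ε : ℝ => mdimMRate T d ε) (𝓝[>] (0 : ℝ))

/-- `widim_ε(X, ρ)`: the minimal `k` such that there are a finite simplicial complex of
dimension `≤ k` (realized in some `ℝ^m`) and a continuous `ε`-embedding `f : X → P`
(all fibers of `f` have `ρ`-diameter `< ε`). -/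
def widim (X : Type*) [TopologicalSpace X] (ρ : X → X → ℝ) (ε : ℝ) : ℕ :=
  sInf {k : ℕ | ∃ (m : ℕ) (K : Geometry.SimplicialComplex ℝ (Fin m → ℝ)),
    K.faces.Finite ∧ (∀ s ∈ K.faces, s.card ≤ k + 1) ∧
    ∃ f : X → K.space, Continuous f ∧
      ∀ p : K.space, setEDiam ρ (f ⁻¹' {p}) < ENNReal.ofReal ε}

/-- Mean dimension `mdim(X, T) = lim_{ε→0} lim_{N→∞} widim_ε(X, d_N)/N`. -/
def mdim (X : Type*) [TopologicalSpace X] (T : X → X) (d : X → X → ℝ) : EReal :=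
  Filter.limsup (fun ε : ℝ => Filter.liminf
      (fun N : ℕ => (((widim X (dynDist T d N) ε : ℝ) / N : ℝ) : EReal)) Filter.atTop)
    (𝓝[>] (0 : ℝ))

/-- The cube `[0,1]^a`. -/
abbrev Cube (a : ℕ) := Fin a → unitInterval

/-- The full shift space `([0,1]^a)^ℤ`. -/
abbrev FullShift (a : ℕ) := ℤ → Cube a

/-- The shift map `σ((x_n)_n) = (x_{n+1})_n`. -/
def shift {α : Type*} (x : ℤ → α) : ℤ → α := fun n => x (n + 1)

/-- The `ℓ^∞`-distance on the cube `[0,1]^a`. -/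
def cubeDist {a : ℕ} (x y : Cube a) : ℝ :=
  ‖(fun i => (x i : ℝ)) - fun i => (y i : ℝ)‖

/-- The metric `D((x_n), (y_n)) = Σ_{n∈ℤ} 2^{-|n|} ‖x_n − y_n‖_∞` on the full shift. -/
def shiftDist {a : ℕ} (x y : FullShift a) : ℝ :=
  ∑' n : ℤ, (2 : ℝ) ^ (-|n|) * cubeDist (x n) (y n)

end

section Brouwer

variable {E : Type*} [NormedAddCommGroup E] [NormedSpace ℝ E]

theorem exists_norm_eq_dist_le {x y : E} {R : ℝ} (hx : ‖x‖ ≤ R) (hy : R ≤ ‖y‖) :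
    ∃ z, ‖z‖ = R ∧ dist x z ≤ dist x y := by
  have hc : ContinuousOn (fun t : ℝ => ‖AffineMap.lineMap x y t‖) (Set.Icc 0 1) := by
    refine Continuous.continuousOn ?_
    exact continuous_norm.comp AffineMap.lineMap_continuous
  have := intermediate_value_Icc (zero_le_one) hc
  obtain ⟨t, ht, hR⟩ := this (show R ∈ _ by simpa using ⟨hx, hy⟩)
  refine ⟨_, hR, ?_⟩
  rw [dist_left_lineMap, Real.norm_of_nonneg ht.1]
  exact mul_le_of_le_one_left dist_nonneg ht.2

/-- A Lipschitz function on a closed ball vanishing on the sphere, extended by zero. -/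
theorem LipschitzOnWith.indicator_closedBall {g : E → E} {L : ℝ≥0} {R : ℝ}
    (hg : LipschitzOnWith L g (Metric.closedBall 0 R)) (h0 : ∀ x, ‖x‖ = R → g x = 0) :
    LipschitzWith L ((Metric.closedBall (0 : E) R).indicator g) := by
  have key : ∀ x y : E, ‖x‖ ≤ R → R < ‖y‖ → dist (g x) 0 ≤ L * dist x y := by
    intro x y hx hy
    obtain ⟨z, hz, hd⟩ := exists_norm_eq_dist_le hx hy.le
    have := hg.dist_le_mul x (by simpa using hx) z (by simpa using hz.le)
    rw [h0 z hz] at this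
    exact this.trans (by gcongr)
  refine LipschitzWith.of_dist_le_mul fun x y => ?_
  by_cases hx : x ∈ Metric.closedBall (0 : E) R <;> by_cases hy : y ∈ Metric.closedBall (0 : E) R
  · simpa [Set.indicator_of_mem, hx, hy] using hg.dist_le_mul x hx y hy
  · rw [Set.indicator_of_mem hx, Set.indicator_of_notMem hy]
    exact key x y (by simpa using hx) (by simpa using hy)
  · rw [Set.indicator_of_mem hy, Set.indicator_of_notMem hx, dist_comm, dist_comm x]
    exact key y x (by simpa using hy) (by simpa using hx)
  · rw [Set.indicator_of_notMem hy, Set.indicator_of_notMem hx]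
    simp only [dist_self]; positivity

theorem image_closedBall_id_add [CompleteSpace E] {g : E → E} {L : ℝ≥0} {R t : ℝ}
    (hg : LipschitzOnWith L g (Metric.closedBall 0 R)) (h0 : ∀ x, ‖x‖ = R → g x = 0)
    (hmap : ∀ x, ‖x‖ ≤ R → ‖x + g x‖ ≤ R) (ht : 0 ≤ t) (ht1 : t ≤ 1) (htL : t * L < 1) :
    (fun x => x + t • g x) '' Metric.closedBall 0 R = Metric.closedBall 0 R := by
  ext y
  constructor
  · rintro ⟨x, hx, rfl⟩
    have hx' : ‖x‖ ≤ R := by simpa using hx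
    have : x + t • g x = (1 - t) • x + t • (x + g x) := by module
    simp only [mem_closedBall_zero_iff, this]
    calc _ ≤ (1 - t) * ‖x‖ + t * ‖x + g x‖ := by
          refine (norm_add_le _ _).trans ?_
          rw [norm_smul, norm_smul, Real.norm_of_nonneg ht, Real.norm_of_nonneg (by linarith)]
      _ ≤ (1 - t) * R + t * R := by
          have := hmap x hx'
          have : 0 ≤ 1 - t := by linarith
          gcongr
      _ = R := by ring
  · intro hy
    set G := (Metric.closedBall (0 : E) R).indicator g
    have hG := hg.indicator_closedBall h0
    have hK : ContractingWith (t.toNNReal * L) (fun x => y - t • G x) := by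
      refine ⟨?_, ?_⟩
      · rw [← NNReal.coe_lt_coe]; simpa [ht] using htL
      · refine LipschitzWith.of_dist_le_mul fun a b => ?_
        rw [dist_sub_left, dist_smul₀, Real.norm_of_nonneg ht]
        have := hG.dist_le_mul a b
        rw [NNReal.coe_mul, Real.coe_toNNReal _ ht, mul_assoc]
        exact mul_le_mul_of_nonneg_left this ht
    have hfix : y - t • G (hK.fixedPoint) = hK.fixedPoint := hK.fixedPoint_isFixedPt
    set x := hK.fixedPoint
    by_cases hx : x ∈ Metric.closedBall (0 : E) R
    · refine ⟨x, hx, ?_⟩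
      simp only [G, Set.indicator_of_mem hx] at hfix
      rw [sub_eq_iff_eq_add] at hfix
      exact hfix.symm
    · simp only [G, Set.indicator_of_notMem hx, smul_zero, sub_zero] at hfix
      exact absurd (hfix ▸ hy) hx

theorem injOn_id_add {g : E → E} {L : ℝ≥0} {s : Set E} {t : ℝ}
    (hg : LipschitzOnWith L g s) (ht : 0 ≤ t) (htL : t * L < 1) :
    Set.InjOn (fun x => x + t • g x) s := by
  intro a ha b hb hab
  have h1 := hg.dist_le_mul a ha b hb
  have h2 : a - b = t • (g b - g a) := by
    have : a + t • g a = b + t • g b := hab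
    rw [smul_sub, sub_eq_sub_iff_add_eq_add, this, add_comm]
  have h3 : dist a b = t * dist (g a) (g b) := by
    rw [dist_eq_norm, h2, norm_smul, Real.norm_of_nonneg ht, dist_comm (g a), dist_eq_norm (g b)]
  have h4 : dist a b ≤ t * L * dist a b := by
    rw [mul_assoc]; exact h3.le.trans (mul_le_mul_of_nonneg_left h1 ht)
  have : dist a b = 0 := by
    by_contra hne
    have : 0 < dist a b := lt_of_le_of_ne dist_nonneg (Ne.symm hne)
    nlinarith
  exact dist_eq_zero.1 this

theorem det_id_add_smul_pos [FiniteDimensional ℝ E] {A : E →L[ℝ] E} {L t : ℝ}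
    (hA : ‖A‖ ≤ L) (ht : 0 ≤ t) (htL : t * L < 1) :
    0 < (ContinuousLinearMap.id ℝ E + t • A).det := by
  have hne : ∀ τ ∈ Set.Icc 0 t, (ContinuousLinearMap.id ℝ E + τ • A).det ≠ 0 := by
    intro τ hτ h
    have hb := LinearMap.bot_lt_ker_of_det_eq_zero (f := (ContinuousLinearMap.id ℝ E + τ • A : E →L[ℝ] E).toLinearMap) h
    obtain ⟨v, hv, hv0⟩ := Submodule.exists_mem_ne_zero_of_ne_bot hb.ne'
    have hv' : v + τ • A v = 0 := by simpa using hv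
    have h1 : ‖v‖ = τ * ‖A v‖ := by
      conv_lhs => rw [eq_neg_of_add_eq_zero_left hv', norm_neg, norm_smul, Real.norm_of_nonneg hτ.1]
    have h2 : ‖A v‖ ≤ L * ‖v‖ := (A.le_opNorm v).trans (by gcongr)
    have hvp : 0 < ‖v‖ := norm_pos_iff.2 hv0
    have hL : 0 ≤ L := (norm_nonneg _).trans hA
    have h3 : ‖v‖ ≤ (t * L) * ‖v‖ := by
      calc ‖v‖ = τ * ‖A v‖ := h1
        _ ≤ t * (L * ‖v‖) := mul_le_mul hτ.2 h2 (norm_nonneg _) ht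
        _ = _ := by ring
    nlinarith
  have hc : ContinuousOn (fun τ : ℝ => (ContinuousLinearMap.id ℝ E + τ • A).det) (Set.Icc 0 t) := by
    refine Continuous.continuousOn ?_
    exact ContinuousLinearMap.continuous_det.comp (by fun_prop)
  by_contra hneg
  obtain ⟨τ, hτ, h0⟩ := intermediate_value_Icc' ht hc
    (show (0 : ℝ) ∈ _ from ⟨not_lt.1 hneg, by simp [ContinuousLinearMap.det]⟩)
  exact hne τ hτ h0

theorem det_id_add_smul_interpolate [FiniteDimensional ℝ E] (A : E →L[ℝ] E) {ι : Type*} [DecidableEq ι]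
    (s : Finset ι) (v : ι → ℝ) (hv : Set.InjOn v s) (hs : Module.finrank ℝ E < s.card) (t : ℝ) :
    (ContinuousLinearMap.id ℝ E + t • A).det =
      ∑ i ∈ s, (ContinuousLinearMap.id ℝ E + v i • A).det * (Lagrange.basis s v i).eval t := by
  classical
  let b := Module.finBasis ℝ E
  let B := LinearMap.toMatrix b b A.toLinearMap
  let p : Polynomial ℝ := Matrix.det ((Polynomial.X : Polynomial ℝ) • B.map Polynomial.C +
    (1 : Matrix _ _ ℝ).map Polynomial.C)
  have hp : ∀ τ : ℝ, p.eval τ = (ContinuousLinearMap.id ℝ E + τ • A).det := by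
    intro τ
    have h1 : p.eval τ = (1 + τ • B).det := by
      rw [← Polynomial.coe_evalRingHom, RingHom.map_det]
      congr 1
      ext i j
      by_cases hij : i = j <;> simp [hij, add_comm] <;> exact mul_comm _ _
    rw [h1]
    change _ = LinearMap.det _
    rw [← LinearMap.det_toMatrix b]
    congr 1
    simp [B, ContinuousLinearMap.toLinearMap_add]
  have hdeg : p.degree < s.card := by
    refine Polynomial.degree_le_natDegree.trans_lt ?_
    have := Polynomial.natDegree_det_X_add_C_le B 1
    rw [Fintype.card_fin] at this
    exact_mod_cast this.trans_lt hs
  have := congrArg (Polynomial.eval t) (Lagrange.eq_interpolate hv hdeg)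
  rw [hp, Lagrange.interpolate_apply, Polynomial.eval_finsetSum] at this
  rw [this]
  refine Finset.sum_congr rfl fun i _ => ?_
  rw [Polynomial.eval_mul, Polynomial.eval_C, hp]


open MeasureTheory in
theorem not_contDiff_retraction {E : Type*} [NormedAddCommGroup E] [InnerProductSpace ℝ E]
    [FiniteDimensional ℝ E] {r : E → E} {R : ℝ} (hR : 0 < R) (hr : ContDiff ℝ 1 r)
    (h1 : ∀ x, ‖r x‖ = R) (h2 : ∀ x, ‖x‖ = R → r x = x) : False := by
  let _ : MeasurableSpace E := borel E
  have : BorelSpace E := ⟨rfl⟩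
  set B := Metric.closedBall (0 : E) R
  have hBc : IsCompact B := isCompact_closedBall _ _
  have hBm : MeasurableSet B := hBc.measurableSet
  set g : E → E := fun x => r x - x with hgdef
  have hg : ContDiff ℝ 1 g := hr.sub contDiff_id
  have hg' : Continuous (fderiv ℝ g) := hg.continuous_fderiv one_ne_zero
  have hgd : Differentiable ℝ g := hg.differentiable one_ne_zero
  obtain ⟨L', hL'⟩ := (hBc.image hg').isBounded.exists_norm_le
  set L : ℝ≥0 := L'.toNNReal
  have hL : ∀ x ∈ B, ‖fderiv ℝ g x‖ ≤ L := fun x hx =>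
    (hL' _ ⟨x, hx, rfl⟩).trans (Real.le_coe_toNNReal _)
  have hLip : LipschitzOnWith L g B :=
    (convex_closedBall _ _).lipschitzOnWith_of_nnnorm_fderiv_le (fun x _ => hgd x)
      (fun x hx => hL x hx)
  have h0 : ∀ x, ‖x‖ = R → g x = 0 := fun x hx => by simp [hgdef, h2 x hx]
  have hvol : ∀ t : ℝ, 0 ≤ t → t ≤ 1 → t * L < 1 →
      ∫ x in B, (ContinuousLinearMap.id ℝ E + t • fderiv ℝ g x).det ∂Measure.addHaar =
        (Measure.addHaar : Measure E).real B := by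
    intro t ht ht1 htL
    have himg := image_closedBall_id_add hLip h0 (fun x _ => by simp [hgdef, h1 x]) ht ht1 htL
    have hd : ∀ x ∈ B, HasFDerivWithinAt (fun x => x + t • g x)
        (ContinuousLinearMap.id ℝ E + t • fderiv ℝ g x) B x := fun x _ =>
      ((hasFDerivAt_id x).add ((hgd x).hasFDerivAt.const_smul t)).hasFDerivWithinAt
    have := integral_image_eq_integral_abs_det_fderiv_smul Measure.addHaar hBm hd
      (injOn_id_add hLip ht htL) (fun _ => (1 : ℝ))
    rw [himg] at this
    simp only [smul_eq_mul, mul_one, integral_const, measureReal_restrict_apply_univ] at this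
    rw [this]
    refine setIntegral_congr_fun hBm fun x hx => ?_
    exact (abs_of_pos (det_id_add_smul_pos (hL x hx) ht htL)).symm
  set n := Module.finrank ℝ E
  set v : ℕ → ℝ := fun i => (i + 1 : ℝ) / ((n + 1) * (L + 1)) with hv
  have hden : (0 : ℝ) < (n + 1) * (L + 1) := by positivity
  have hvinj : Set.InjOn v (Finset.range (n + 1)) := by
    intro i _ j _ hij
    simp only [hv] at hij
    rw [div_left_inj' hden.ne'] at hij
    exact_mod_cast add_right_cancel hij
  have hvle : ∀ i ∈ Finset.range (n + 1), 0 ≤ v i ∧ v i ≤ 1 ∧ v i * L < 1 := by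
    intro i hi
    have hi' : (i + 1 : ℝ) ≤ n + 1 := by
      have := Finset.mem_range.1 hi; exact_mod_cast this
    have hLn : (0 : ℝ) ≤ L := L.2
    have hnn : (0 : ℝ) ≤ n := Nat.cast_nonneg n
    refine ⟨by simp only [hv]; positivity, ?_, ?_⟩
    · simp only [hv]
      rw [div_le_one hden]; nlinarith
    · simp only [hv]
      rw [div_mul_eq_mul_div, div_lt_one hden]; nlinarith
  have hcont : ∀ t : ℝ, Continuous
      fun x => (ContinuousLinearMap.id ℝ E + t • fderiv ℝ g x).det := fun t =>
    ContinuousLinearMap.continuous_det.comp (by fun_prop)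
  have hint : ∀ t : ℝ, IntegrableOn
      (fun x => (ContinuousLinearMap.id ℝ E + t • fderiv ℝ g x).det) B Measure.addHaar := fun t =>
    (hcont t).continuousOn.integrableOn_compact hBc
  have hdet1 : ∀ x, (ContinuousLinearMap.id ℝ E + (1 : ℝ) • fderiv ℝ g x).det = 0 := by
    intro x
    have hrd := (hr.differentiable one_ne_zero x)
    have hfd : fderiv ℝ g x = fderiv ℝ r x - ContinuousLinearMap.id ℝ E := by
      exact (hrd.hasFDerivAt.sub (hasFDerivAt_id x)).fderiv
    rw [hfd, one_smul, add_sub_cancel]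
    by_contra hne
    have hsurj : Function.Surjective (fderiv ℝ r x) := by
      have hb := LinearMap.isUnit_iff_range_eq_top (f := (fderiv ℝ r x).toLinearMap) |>.1
        ((LinearMap.isUnit_iff_isUnit_det _).2 (isUnit_iff_ne_zero.2 hne))
      exact LinearMap.range_eq_top.1 hb
    obtain ⟨w, hw⟩ := hsurj (r x)
    have hconst : HasFDerivAt (fun y => inner ℝ (r y) (r y)) (0 : E →L[ℝ] ℝ) x := by
      have : (fun y => inner ℝ (r y) (r y)) = fun _ => R ^ 2 := by
        funext y; rw [real_inner_self_eq_norm_sq, h1]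
      rw [this]; exact hasFDerivAt_const _ _
    have hinn := hrd.hasFDerivAt.inner ℝ hrd.hasFDerivAt
    have := congrArg (fun A : E →L[ℝ] ℝ => A w) (hconst.unique hinn)
    simp [hw, h1] at this
    nlinarith
  have hsum : (0 : ℝ) = (Measure.addHaar : Measure E).real B := by
    calc (0 : ℝ) = ∫ x in B, (ContinuousLinearMap.id ℝ E + (1 : ℝ) • fderiv ℝ g x).det
          ∂Measure.addHaar := by simp only [hdet1, integral_zero]
      _ = ∫ x in B, ∑ i ∈ Finset.range (n + 1),
          (ContinuousLinearMap.id ℝ E + v i • fderiv ℝ g x).det *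
            (Lagrange.basis (Finset.range (n + 1)) v i).eval 1 ∂Measure.addHaar := by
          refine setIntegral_congr_fun hBm fun x _ => ?_
          exact det_id_add_smul_interpolate _ _ v hvinj (by simp [n]) 1
      _ = ∑ i ∈ Finset.range (n + 1), (Measure.addHaar : Measure E).real B *
            (Lagrange.basis (Finset.range (n + 1)) v i).eval 1 := by
          rw [integral_finsetSum _ fun i _ => (hint _).mul_const _]
          refine Finset.sum_congr rfl fun i hi => ?_
          obtain ⟨ha, hb, hc⟩ := hvle i hi
          rw [integral_mul_const, hvol _ ha hb hc]
      _ = _ := by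
          rw [← Finset.mul_sum, ← Polynomial.eval_finsetSum,
            Lagrange.sum_basis hvinj (by simp), Polynomial.eval_one, mul_one]
  have hpos : 0 < (Measure.addHaar : Measure E).real B :=
    ENNReal.toReal_pos (Metric.measure_closedBall_pos _ _ hR).ne' hBc.measure_lt_top.ne
  exact hpos.ne hsum

theorem exists_fixedPoint_of_contDiff {E : Type*} [NormedAddCommGroup E] [InnerProductSpace ℝ E]
    [FiniteDimensional ℝ E] {G : E → E} {R : ℝ} (hR : 0 < R) (hG : ContDiff ℝ 1 G)
    (h0 : ∀ x, ‖x‖ = R → G x = 0) : ∃ x, G x = x := by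
  by_contra! hne
  have hne' : ∀ x, x - G x ≠ 0 := fun x h => hne x (sub_eq_zero.1 h).symm
  refine not_contDiff_retraction (r := fun x => (R * ‖x - G x‖⁻¹) • (x - G x)) hR ?_ ?_ ?_
  · have h1 : ContDiff ℝ 1 fun x => x - G x := contDiff_id.sub hG
    exact (contDiff_const.mul ((h1.norm ℝ hne').inv fun x => norm_ne_zero_iff.2 (hne' x))).smul h1
  · intro x
    rw [norm_smul, norm_mul, norm_inv, norm_norm, Real.norm_of_nonneg hR.le, mul_assoc,
      inv_mul_cancel₀ (norm_ne_zero_iff.2 (hne' x)), mul_one]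
  · intro x hx
    simp [h0 x hx, hx, hR.ne']

/-- Brouwer fixed point theorem for bounded continuous self-maps of a Euclidean space. -/
theorem exists_fixedPoint_of_bounded {E : Type*} [NormedAddCommGroup E] [InnerProductSpace ℝ E]
    [FiniteDimensional ℝ E] {G : E → E} {C : ℝ} (hG : Continuous G) (hC : ∀ x, ‖G x‖ ≤ C) :
    ∃ x, G x = x := by
  have hC0 : 0 ≤ C := (norm_nonneg _).trans (hC 0)
  let χ : ContDiffBump (0 : E) := ⟨C + 1, C + 2, by linarith, by linarith⟩
  by_contra! hne
  have hne1 : ∀ x, 0 < ‖x - χ x • G x‖ := by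
    intro x
    rw [norm_pos_iff, sub_ne_zero]
    intro h
    have hx : ‖x‖ ≤ C := by
      rw [h, norm_smul, Real.norm_of_nonneg χ.nonneg]
      exact (mul_le_of_le_one_left (norm_nonneg _) χ.le_one).trans (hC x)
    have : χ x = 1 := χ.one_of_mem_closedBall (by
      rw [mem_closedBall_zero_iff]
      change ‖x‖ ≤ C + 1
      linarith)
    rw [this, one_smul] at h
    exact hne x h.symm
  have hzero : ∀ x : E, C + 2 ≤ ‖x‖ → χ x = 0 := fun x hx =>
    χ.zero_of_le_dist (by simpa using hx)
  obtain ⟨H, hH, hHG, -⟩ := hG.exists_contDiff_approx (ε := fun x => ‖x - χ x • G x‖) 1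
    (by have := χ.continuous; fun_prop) hne1
  obtain ⟨x, hx⟩ := exists_fixedPoint_of_contDiff (G := fun x => χ x • H x) (R := C + 2)
    (by linarith) (χ.contDiff.smul hH) (fun x hx => by simp [hzero x hx.ge])
  have h1 : ‖x - χ x • G x‖ ≤ dist (H x) (G x) := by
    nth_rewrite 1 [← hx]
    rw [← smul_sub, norm_smul, Real.norm_of_nonneg χ.nonneg, dist_eq_norm]
    exact mul_le_of_le_one_left (norm_nonneg _) χ.le_one
  exact absurd (hHG x) (not_lt.2 h1)

end Brouwer

section QuadraticForms
open scoped Matrix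
variable {ι : Type*} [Fintype ι]

/-- A symmetric real matrix whose quadratic form lies between `0` and `r` times the square norm. -/
structure QuadBdd (A : Matrix ι ι ℝ) (r : ℝ) : Prop where
  symm : Aᵀ = A
  nonneg : ∀ x : ι → ℝ, 0 ≤ x ⬝ᵥ A *ᵥ x
  le : ∀ x : ι → ℝ, x ⬝ᵥ A *ᵥ x ≤ r * (x ⬝ᵥ x)

theorem dotProduct_mulVec_symm {A : Matrix ι ι ℝ} (hA : Aᵀ = A) (x y : ι → ℝ) :
    x ⬝ᵥ A *ᵥ y = y ⬝ᵥ A *ᵥ x := by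
  rw [Matrix.dotProduct_mulVec, ← Matrix.mulVec_transpose, hA, dotProduct_comm]

theorem QuadBdd.sq_le {A : Matrix ι ι ℝ} {r : ℝ} (hA : QuadBdd A r) (x y : ι → ℝ) :
    (x ⬝ᵥ A *ᵥ y) ^ 2 ≤ (x ⬝ᵥ A *ᵥ x) * (y ⬝ᵥ A *ᵥ y) := by
  have h : ∀ t : ℝ, 0 ≤ (y ⬝ᵥ A *ᵥ y) * (t * t) + (2 * (x ⬝ᵥ A *ᵥ y)) * t + x ⬝ᵥ A *ᵥ x := by
    intro t
    have := hA.nonneg (x + t • y)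
    simp only [Matrix.mulVec_add, Matrix.mulVec_smul, dotProduct_add, add_dotProduct,
      smul_dotProduct, dotProduct_smul, smul_eq_mul, dotProduct_mulVec_symm hA.symm y x] at this
    linarith
  have := discrim_le_zero h
  rw [discrim] at this
  nlinarith

theorem dotProduct_sq_le (x y : ι → ℝ) : (x ⬝ᵥ y) ^ 2 ≤ (x ⬝ᵥ x) * (y ⬝ᵥ y) := by
  simp only [dotProduct, ← sq]
  exact Finset.sum_mul_sq_le_sq_mul_sq _ _ _

theorem dotProduct_self_nonneg' (x : ι → ℝ) : 0 ≤ x ⬝ᵥ x := by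
  simp only [dotProduct]; exact Finset.sum_nonneg fun i _ => mul_self_nonneg _

theorem QuadBdd.mulVec_sq_le {A : Matrix ι ι ℝ} (hA : QuadBdd A 1) (x : ι → ℝ) :
    A *ᵥ x ⬝ᵥ A *ᵥ x ≤ x ⬝ᵥ A *ᵥ x := by
  set y := A *ᵥ x
  have h1 := hA.sq_le y x
  have h2 := hA.le y
  have h3 := dotProduct_self_nonneg' y
  have h4 := hA.nonneg x
  change (y ⬝ᵥ y) ^ 2 ≤ _ at h1
  have h5 : (y ⬝ᵥ y) ^ 2 ≤ (y ⬝ᵥ y) * (x ⬝ᵥ y) := h1.trans (by gcongr; linarith)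
  rcases h3.eq_or_lt with h | h
  · rw [← h]; exact h4
  · nlinarith

theorem QuadBdd.mono {A : Matrix ι ι ℝ} {r r' : ℝ} (hA : QuadBdd A r) (h : r ≤ r') :
    QuadBdd A r' :=
  ⟨hA.symm, hA.nonneg, fun x => (hA.le x).trans
    (mul_le_mul_of_nonneg_right h (dotProduct_self_nonneg' x))⟩

variable [DecidableEq ι]

theorem posDef_add_smul {A : Matrix ι ι ℝ} {r ρ : ℝ} (hA : QuadBdd A r) (hρ : 0 < ρ) :
    (A + ρ • (1 : Matrix ι ι ℝ)).PosDef := by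
  refine Matrix.PosDef.of_dotProduct_mulVec_pos ?_ ?_
  · rw [Matrix.IsHermitian, Matrix.conjTranspose_eq_transpose_of_trivial]
    simp [hA.symm]
  · intro x hx
    have h1 := hA.nonneg x
    have h2 : 0 < x ⬝ᵥ x := by
      have := (Matrix.dotProduct_star_self_pos_iff (v := x)).2 hx
      simpa using this
    simp only [star_trivial, Matrix.add_mulVec, Matrix.smul_mulVec, Matrix.one_mulVec,
      dotProduct_add, dotProduct_smul, smul_eq_mul]
    positivity

/-- The unnormalised Gaussian weight with covariance `S`. -/
noncomputable def gaussWeight (S : Matrix ι ι ℝ) (x : ι → ℝ) : ℝ :=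
  (Real.sqrt S.det)⁻¹ * Real.exp (-(x ⬝ᵥ S⁻¹ *ᵥ x) / 2)

theorem gaussWeight_nonneg (S : Matrix ι ι ℝ) (x : ι → ℝ) : 0 ≤ gaussWeight S x := by
  unfold gaussWeight; positivity

theorem det_sub_vecMulVec {S : Matrix ι ι ℝ} (hS : IsUnit S.det) (v : ι → ℝ) :
    (S - Matrix.vecMulVec v v).det = S.det * (1 - v ⬝ᵥ S⁻¹ *ᵥ v) := by
  have h : S - Matrix.vecMulVec v v = S * (1 - Matrix.vecMulVec (S⁻¹ *ᵥ v) v) := by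
    rw [mul_sub, mul_one, Matrix.mul_vecMulVec, Matrix.mulVec_mulVec, Matrix.mul_nonsing_inv _ hS,
      Matrix.one_mulVec]
  rw [h, Matrix.det_mul, Matrix.vecMulVec_eq Unit, Matrix.det_one_sub_mul_comm, Matrix.det_unique (n := Unit)]
  simp [Matrix.mul_apply, dotProduct]

theorem inv_sub_vecMulVec_mulVec {S : Matrix ι ι ℝ} (hS : IsUnit S.det) (v y : ι → ℝ)
    (hv : v ⬝ᵥ S⁻¹ *ᵥ v < 1) :
    (S - Matrix.vecMulVec v v)⁻¹ *ᵥ y =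
      S⁻¹ *ᵥ y + ((v ⬝ᵥ S⁻¹ *ᵥ y) / (1 - v ⬝ᵥ S⁻¹ *ᵥ v)) • S⁻¹ *ᵥ v := by
  have hne : 1 - v ⬝ᵥ S⁻¹ *ᵥ v ≠ 0 := by linarith
  have hu : IsUnit (S - Matrix.vecMulVec v v).det := by
    rw [det_sub_vecMulVec hS]; exact hS.mul hne.isUnit
  have h : (S - Matrix.vecMulVec v v) *ᵥ (S⁻¹ *ᵥ y +
      ((v ⬝ᵥ S⁻¹ *ᵥ y) / (1 - v ⬝ᵥ S⁻¹ *ᵥ v)) • S⁻¹ *ᵥ v) = y := by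
    have hinv : ∀ w, S *ᵥ S⁻¹ *ᵥ w = w := fun w => by
      rw [Matrix.mulVec_mulVec, Matrix.mul_nonsing_inv _ hS, Matrix.one_mulVec]
    rw [Matrix.sub_mulVec, Matrix.mulVec_add, Matrix.mulVec_smul, hinv, hinv,
      Matrix.vecMulVec_mulVec, dotProduct_add, dotProduct_smul, smul_eq_mul]
    ext i
    simp only [Pi.sub_apply, Pi.add_apply, Pi.smul_apply, smul_eq_mul, MulOpposite.smul_eq_mul_unop,
      MulOpposite.unop_op]
    field_simp
    ring
  conv_lhs => rw [← h]
  rw [Matrix.mulVec_mulVec, Matrix.nonsing_inv_mul _ hu, Matrix.one_mulVec]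

theorem gaussWeight_sub_vecMulVec {S : Matrix ι ι ℝ} (hS : 0 < S.det) (hsymm : Sᵀ = S)
    (v x : ι → ℝ) (hv : v ⬝ᵥ S⁻¹ *ᵥ v < 1) :
    gaussWeight (S - Matrix.vecMulVec v v) (x - v) = gaussWeight S x *
      ((Real.sqrt (1 - v ⬝ᵥ S⁻¹ *ᵥ v))⁻¹ * Real.exp (v ⬝ᵥ S⁻¹ *ᵥ x - v ⬝ᵥ S⁻¹ *ᵥ v / 2 -
        (v ⬝ᵥ S⁻¹ *ᵥ x - v ⬝ᵥ S⁻¹ *ᵥ v) ^ 2 / (2 * (1 - v ⬝ᵥ S⁻¹ *ᵥ v)))) := by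
  have hSu : IsUnit S.det := hS.ne'.isUnit
  have hne : 1 - v ⬝ᵥ S⁻¹ *ᵥ v ≠ 0 := by linarith
  have hsymm' : (S⁻¹)ᵀ = S⁻¹ := by rw [Matrix.transpose_nonsing_inv, hsymm]
  unfold gaussWeight
  rw [det_sub_vecMulVec hSu, Real.sqrt_mul hS.le, mul_inv,
    inv_sub_vecMulVec_mulVec hSu _ _ hv, mul_mul_mul_comm, ← Real.exp_add]
  congr 2
  simp only [Matrix.mulVec_sub, dotProduct_add, sub_dotProduct, dotProduct_sub, dotProduct_smul,
    smul_eq_mul, dotProduct_mulVec_symm hsymm' x v]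
  generalize v ⬝ᵥ S⁻¹ *ᵥ v = β at *
  field_simp
  ring

theorem inv_sqrt_mul_exp_le {t β κ : ℝ} (hκ : 0 ≤ κ) (hκ1 : κ ≤ 1 / 4) (ht : |t| ≤ κ) (hβ : 0 ≤ β)
    (hβκ : β ≤ κ ^ 2) :
    (Real.sqrt (1 - β))⁻¹ * Real.exp (t - β / 2 - (t - β) ^ 2 / (2 * (1 - β))) ≤
      1 + t + 12 * κ ^ 3 := by
  have hβ1 : β ≤ 1 / 16 := hβκ.trans (by nlinarith)
  have h1β : 0 < 1 - β := by linarith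
  obtain ⟨ht1, ht2⟩ := abs_le.1 ht
  have hsqrt : (Real.sqrt (1 - β))⁻¹ = Real.exp (-(Real.log (1 - β)) / 2) := by
    rw [Real.sqrt_eq_rpow, Real.rpow_def_of_pos h1β, ← Real.exp_neg]; congr 1; ring
  have hlog : -Real.log (1 - β) ≤ β + 2 * β ^ 2 := by
    have := Real.one_sub_inv_le_log_of_pos h1β
    have h2 : (1 - β)⁻¹ ≤ 1 + β + 2 * β ^ 2 := by
      rw [inv_le_iff_one_le_mul₀ h1β]; nlinarith [pow_nonneg hβ 2]
    linarith
  have hquad : (t - β) ^ 2 / 2 ≤ (t - β) ^ 2 / (2 * (1 - β)) := by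
    apply div_le_div_of_nonneg_left (sq_nonneg _) (by linarith) (by linarith)
  have htβ : t * β ≤ κ ^ 3 := by
    calc t * β ≤ κ * β := by gcongr
      _ ≤ κ * κ ^ 2 := by gcongr
      _ = κ ^ 3 := by ring
  have hβ2 : β ^ 2 ≤ κ ^ 3 := by
    calc β ^ 2 ≤ (κ ^ 2) ^ 2 := by gcongr
      _ = κ * κ ^ 3 := by ring
      _ ≤ 1 * κ ^ 3 := by gcongr; linarith
      _ = _ := one_mul _
  set σ := t - t ^ 2 / 2 + 2 * κ ^ 3 with hσ
  have hκ3 : κ ^ 3 ≤ κ ^ 2 / 4 := by nlinarith [sq_nonneg κ]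
  have hκ3' : 0 ≤ κ ^ 3 := by positivity
  have ht2' : t ^ 2 ≤ κ ^ 2 := sq_le_sq' ht1 ht2
  have hκ2 : κ ^ 2 ≤ κ / 4 := by nlinarith
  have hσt : |σ - t| ≤ κ ^ 2 / 2 + κ ^ 2 / 2 := by
    rw [abs_le]; constructor <;> nlinarith [sq_nonneg t]
  have hσκ : |σ| ≤ 2 * κ := by
    have : |σ| ≤ |σ - t| + |t| := by simpa using abs_add_le (σ - t) t
    linarith
  have hexp : Real.exp σ ≤ 1 + σ + σ ^ 2 / 2 + |σ| ^ 3 := by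
    have := Real.exp_bound (x := σ) (by linarith) (n := 3) (by norm_num)
    have h3 := (abs_le.1 this).2
    simp [Finset.sum_range_succ, Nat.factorial] at h3
    nlinarith [pow_nonneg (abs_nonneg σ) 3]
  have hσ3 : |σ| ^ 3 ≤ 8 * κ ^ 3 := by
    calc |σ| ^ 3 ≤ (2 * κ) ^ 3 := by gcongr
      _ = _ := by ring
  have hσ2 : σ ^ 2 ≤ t ^ 2 + 3 * κ ^ 3 := by
    have h1 : (σ - t) * (σ + t) ≤ κ ^ 2 * (3 * κ) := by
      refine (le_abs_self _).trans ?_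
      rw [abs_mul]
      gcongr
      · linarith
      · refine (abs_add_le _ _).trans ?_; linarith
    nlinarith
  rw [hsqrt, ← Real.exp_add]
  calc _ ≤ Real.exp σ := by
        apply Real.exp_le_exp.2
        nlinarith
    _ ≤ _ := by linarith

end QuadraticForms

section Localization
open scoped Matrix

section Pointwise
variable {ι : Type*} [Fintype ι] {A : Matrix ι ι ℝ} {ρ : ℝ}

theorem QuadBdd.sub_vecMulVec {r : ℝ} (hA : QuadBdd A r) (hr : r ≤ 1) {h : ℝ} (hh : 0 ≤ h)
    (hh1 : h ≤ 1) {u : ι → ℝ} (hu : u ⬝ᵥ u = 1) :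
    QuadBdd (A - Matrix.vecMulVec (h • A *ᵥ u) (h • A *ᵥ u)) r := by
  have hform : ∀ x, x ⬝ᵥ (A - Matrix.vecMulVec (h • A *ᵥ u) (h • A *ᵥ u)) *ᵥ x =
      x ⬝ᵥ A *ᵥ x - h ^ 2 * (x ⬝ᵥ A *ᵥ u) ^ 2 := by
    intro x
    rw [Matrix.sub_mulVec, Matrix.vecMulVec_mulVec, dotProduct_sub]
    simp only [smul_dotProduct, smul_eq_mul, op_smul_eq_smul, dotProduct_smul,
      dotProduct_comm (A *ᵥ u) x]
    ring
  refine ⟨?_, fun x => ?_, fun x => ?_⟩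
  · rw [Matrix.transpose_sub, hA.symm, Matrix.transpose_vecMulVec]
  · rw [hform]
    have h1 := hA.sq_le x u
    have h2 := (hA.mono hr).le u
    have h3 := hA.nonneg x
    have h4 := hA.nonneg u
    have h5 : (x ⬝ᵥ A *ᵥ u) ^ 2 ≤ x ⬝ᵥ A *ᵥ x := h1.trans (by
      rw [hu] at h2; nlinarith)
    have h6 : h ^ 2 ≤ 1 := by nlinarith
    nlinarith [sq_nonneg (x ⬝ᵥ A *ᵥ u)]
  · rw [hform]
    have := hA.le x
    have : 0 ≤ h ^ 2 * (x ⬝ᵥ A *ᵥ u) ^ 2 := by positivity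
    linarith

variable [DecidableEq ι]

theorem QuadBdd.inv_bounds {r : ℝ} (hA : QuadBdd A r) (hρ : 0 < ρ) (x : ι → ℝ) :
    0 ≤ x ⬝ᵥ (A + ρ • 1)⁻¹ *ᵥ x ∧ ρ * (x ⬝ᵥ (A + ρ • 1)⁻¹ *ᵥ x) ≤ x ⬝ᵥ x ∧
      ρ ^ 2 * ((A + ρ • 1)⁻¹ *ᵥ x ⬝ᵥ (A + ρ • 1)⁻¹ *ᵥ x) ≤ x ⬝ᵥ x := by
  have hS := (posDef_add_smul hA hρ).det_pos.ne'.isUnit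
  set y := (A + ρ • (1 : Matrix ι ι ℝ))⁻¹ *ᵥ x with hy
  have hx : x = A *ᵥ y + ρ • y := by
    have : (A + ρ • (1 : Matrix ι ι ℝ)) *ᵥ y = x := by
      rw [hy, Matrix.mulVec_mulVec, Matrix.mul_nonsing_inv _ hS, Matrix.one_mulVec]
    rw [← this, Matrix.add_mulVec, Matrix.smul_mulVec, Matrix.one_mulVec]
  have h1 : x ⬝ᵥ y = y ⬝ᵥ A *ᵥ y + ρ * (y ⬝ᵥ y) := by
    conv_lhs => rw [hx, dotProduct_comm]
    rw [dotProduct_add, dotProduct_smul, smul_eq_mul]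
  have h2 := hA.nonneg y
  have h3 := dotProduct_self_nonneg' y
  have h3' := dotProduct_self_nonneg' x
  have h4 := dotProduct_sq_le x y
  have h5 : ρ * (y ⬝ᵥ y) ≤ x ⬝ᵥ y := by linarith
  have h6 : 0 ≤ x ⬝ᵥ y := by
    have : 0 ≤ ρ * (y ⬝ᵥ y) := by positivity
    linarith
  refine ⟨h6, ?_, ?_⟩
  · have h7 : ρ * (x ⬝ᵥ y) * (x ⬝ᵥ y) ≤ (x ⬝ᵥ x) * (x ⬝ᵥ y) := by
      calc ρ * (x ⬝ᵥ y) * (x ⬝ᵥ y) = ρ * (x ⬝ᵥ y) ^ 2 := by ring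
        _ ≤ ρ * ((x ⬝ᵥ x) * (y ⬝ᵥ y)) := by gcongr
        _ = (x ⬝ᵥ x) * (ρ * (y ⬝ᵥ y)) := by ring
        _ ≤ _ := by gcongr
    rcases h6.eq_or_lt with h | h
    · rw [← h, mul_zero]; exact h3'
    · exact le_of_mul_le_mul_right h7 h
  · have h7 : ρ ^ 2 * (y ⬝ᵥ y) * (y ⬝ᵥ y) ≤ (x ⬝ᵥ x) * (y ⬝ᵥ y) := by
      calc ρ ^ 2 * (y ⬝ᵥ y) * (y ⬝ᵥ y) = (ρ * (y ⬝ᵥ y)) ^ 2 := by ring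
        _ ≤ (x ⬝ᵥ y) ^ 2 := by gcongr
        _ ≤ _ := h4
    rcases h3.eq_or_lt with h | h
    · rw [← h, mul_zero]; exact h3'
    · exact le_of_mul_le_mul_right h7 h

theorem gaussWeight_step_le {r : ℝ} (hA : QuadBdd A r) (hr : r ≤ 1) (hρ : 0 < ρ) (hρ1 : ρ < 1)
    {h B : ℝ} (hh : 0 ≤ h) (hB : 0 ≤ B) (hhB : h * ((B + 1) / ρ) ≤ 1 / 4)
    {u : ι → ℝ} (hu : u ⬝ᵥ u = 1) {x : ι → ℝ} (hx : x ⬝ᵥ x ≤ B ^ 2) :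
    gaussWeight (A - Matrix.vecMulVec (h • A *ᵥ u) (h • A *ᵥ u) + ρ • 1) (x - h • A *ᵥ u) ≤
      gaussWeight (A + ρ • 1) x * (1 + (h • A *ᵥ u) ⬝ᵥ (A + ρ • 1)⁻¹ *ᵥ x +
        12 * (h * ((B + 1) / ρ)) ^ 3) := by
  have hpd := posDef_add_smul hA hρ
  have hsymm : (A + ρ • (1 : Matrix ι ι ℝ))ᵀ = A + ρ • 1 := by simp [hA.symm]
  set v := h • A *ᵥ u with hv
  set S := A + ρ • (1 : Matrix ι ι ℝ) with hS
  have hS' : A - Matrix.vecMulVec v v + ρ • 1 = S - Matrix.vecMulVec v v := by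
    rw [hS]; abel
  have hvv : v ⬝ᵥ v ≤ h ^ 2 := by
    have h1 := (hA.mono hr).mulVec_sq_le u
    have h2 := (hA.mono hr).le u
    rw [hu] at h2
    rw [hv, smul_dotProduct, dotProduct_smul, smul_eq_mul, smul_eq_mul]
    nlinarith [sq_nonneg h]
  set κ := h * ((B + 1) / ρ) with hκ
  have hκ0 : 0 ≤ κ := by positivity
  obtain ⟨hβ0, hβ1, -⟩ := hA.inv_bounds hρ v
  have hβκ : v ⬝ᵥ S⁻¹ *ᵥ v ≤ κ ^ 2 := by
    have h1 : v ⬝ᵥ S⁻¹ *ᵥ v ≤ h ^ 2 / ρ := by rw [le_div_iff₀ hρ]; linarith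
    refine h1.trans ?_
    rw [hκ, mul_pow, div_pow, div_eq_mul_one_div (h ^ 2)]
    gcongr ?_ * ?_
    rw [div_le_div_iff₀ hρ (by positivity)]
    nlinarith
  have ht : |v ⬝ᵥ S⁻¹ *ᵥ x| ≤ κ := by
    apply abs_le_of_sq_le_sq _ hκ0
    obtain ⟨-, -, h3⟩ := hA.inv_bounds hρ x
    have h4 : S⁻¹ *ᵥ x ⬝ᵥ S⁻¹ *ᵥ x ≤ B ^ 2 / ρ ^ 2 := by
      rw [le_div_iff₀ (by positivity)]; linarith
    calc _ ≤ (v ⬝ᵥ v) * (S⁻¹ *ᵥ x ⬝ᵥ S⁻¹ *ᵥ x) := dotProduct_sq_le _ _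
      _ ≤ h ^ 2 * (B ^ 2 / ρ ^ 2) := mul_le_mul hvv h4 (dotProduct_self_nonneg' _) (sq_nonneg _)
      _ ≤ h ^ 2 * ((B + 1) ^ 2 / ρ ^ 2) := by gcongr; linarith
      _ = κ ^ 2 := by rw [hκ]; ring
  have hβlt : v ⬝ᵥ S⁻¹ *ᵥ v < 1 := by nlinarith
  rw [hS', gaussWeight_sub_vecMulVec hpd.det_pos hsymm v x hβlt]
  gcongr
  · exact gaussWeight_nonneg _ _
  · exact inv_sqrt_mul_exp_le hκ0 hhB ht hβ0 hβκ

end Pointwise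

/-- A topological space in which every continuous map to `ℝ^(k+1)` can be perturbed so as to
avoid the origin. -/
def GenericAvoidance (Z : Type*) [TopologicalSpace Z] (k : ℕ) : Prop :=
  ∀ g : Z → Fin (k + 1) → ℝ, Continuous g → ∀ η > 0,
    ∃ g' : Z → Fin (k + 1) → ℝ, Continuous g' ∧ (∀ p, g' p ≠ 0) ∧ ∀ p, dist (g' p) (g p) ≤ η

theorem GenericAvoidance.exists_unit {Z : Type*} [TopologicalSpace Z] {k : ℕ}
    (hZ : GenericAvoidance Z k) {g : Z → Fin (k + 1) → ℝ} (hg : Continuous g) {η : ℝ}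
    (hη : 0 < η) : ∃ w : Z → Fin (k + 1) → ℝ, Continuous w ∧ (∀ p, w p ⬝ᵥ w p = 1) ∧
      ∀ p, w p ⬝ᵥ g p ≤ η := by
  obtain ⟨g', hg', hne, hd⟩ := hZ g hg (η / (k + 1)) (by positivity)
  have hpos : ∀ p, 0 < g' p ⬝ᵥ g' p := fun p => by
    have := (Matrix.dotProduct_star_self_pos_iff (v := g' p)).2 (hne p)
    simpa using this
  have hspos : ∀ p, 0 < Real.sqrt (g' p ⬝ᵥ g' p) := fun p => Real.sqrt_pos.2 (hpos p)
  have hw1 : ∀ p, (-(Real.sqrt (g' p ⬝ᵥ g' p))⁻¹ • g' p) ⬝ᵥ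
      (-(Real.sqrt (g' p ⬝ᵥ g' p))⁻¹ • g' p) = 1 := by
    intro p
    rw [smul_dotProduct, dotProduct_smul, smul_eq_mul, smul_eq_mul]
    have := Real.mul_self_sqrt (hpos p).le
    have h2 := (hspos p).ne'
    field_simp
    linarith
  refine ⟨fun p => -(Real.sqrt (g' p ⬝ᵥ g' p))⁻¹ • g' p, ?_, hw1, fun p => ?_⟩
  · have h1 : Continuous fun p => g' p ⬝ᵥ g' p := by
      simp only [dotProduct]; fun_prop
    exact ((Real.continuous_sqrt.comp h1).inv₀ fun p => (hspos p).ne').neg.smul hg'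
  · set w := -(Real.sqrt (g' p ⬝ᵥ g' p))⁻¹ • g' p with hw
    have h1 : w ⬝ᵥ g' p ≤ 0 := by
      rw [hw, smul_dotProduct, smul_eq_mul]
      have := hpos p
      have := inv_pos.2 (hspos p)
      nlinarith [mul_pos (hpos p) this]
    have hwl : ∀ l, |w l| ≤ 1 := by
      intro l
      rw [← sq_le_one_iff_abs_le_one, ← hw1 p, ← hw, dotProduct, sq]
      exact Finset.single_le_sum (f := fun l => w l * w l) (fun i _ => mul_self_nonneg _)
        (Finset.mem_univ l)
    have h2 : w ⬝ᵥ (g p - g' p) ≤ η := by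
      calc w ⬝ᵥ (g p - g' p) ≤ ∑ l : Fin (k + 1), η / (k + 1) := by
            refine Finset.sum_le_sum fun l _ => ?_
            refine (le_abs_self _).trans ?_
            rw [abs_mul]
            have h3 : |(g p - g' p) l| ≤ η / (k + 1) := by
              have := (dist_le_pi_dist (g' p) (g p) l).trans (hd p)
              rwa [dist_comm, Real.dist_eq] at this
            calc _ ≤ 1 * (η / (k + 1)) := mul_le_mul (hwl l) h3 (abs_nonneg _) zero_le_one
              _ = _ := one_mul _
        _ = η := by
            simp only [Finset.sum_const, Finset.card_univ, Fintype.card_fin, nsmul_eq_mul]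
            push_cast; field_simp
    rw [dotProduct_sub] at h2
    change w ⬝ᵥ g p ≤ η
    linarith

end Localization

section LocalizationStep
open scoped Matrix

variable {Z J : Type*} [TopologicalSpace Z] [Fintype J] {M k : ℕ}

/-- The potential controlling the localization process: the Gaussian mass of the centers `z j`
with weights `a j`, plus a quadratic term keeping the mean bounded. -/
noncomputable def locPotential (ρ W : ℝ) (z : J → Fin M → ℝ) (a : J → Z → ℝ)
    (m : Z → Fin M → ℝ) (A : Z → Matrix (Fin M) (Fin M) ℝ) (p : Z) : ℝ :=
  (∑ j, a j p * gaussWeight (A p + ρ • 1) (z j - m p)) / W + (m p ⬝ᵥ m p + (A p).trace) / M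

/-- A state of the localization process whose potential is bounded by `c`. -/
structure IsLocState (ρ W : ℝ) (z : J → Fin M → ℝ) (a : J → Z → ℝ)
    (m : Z → Fin M → ℝ) (A : Z → Matrix (Fin M) (Fin M) ℝ) (c : ℝ) : Prop where
  cont_mean : Continuous m
  cont_cov : Continuous A
  bdd : ∀ p, QuadBdd (A p) (1 - ρ)
  pot_le : ∀ p, locPotential ρ W z a m A p ≤ c

theorem QuadBdd.trace_nonneg {ι : Type*} [Fintype ι] [DecidableEq ι] {A : Matrix ι ι ℝ} {r : ℝ}
    (hA : QuadBdd A r) : 0 ≤ A.trace := by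
  refine Finset.sum_nonneg fun i _ => ?_
  simpa using hA.nonneg (Pi.single i 1)

theorem continuous_inv_add_smul {X : Type*} [TopologicalSpace X] {ι : Type*} [Fintype ι]
    [DecidableEq ι] {A : X → Matrix ι ι ℝ} (hA : Continuous A) {ρ r : ℝ} (hρ : 0 < ρ)
    (hb : ∀ p, QuadBdd (A p) r) : Continuous fun p => (A p + ρ • (1 : Matrix ι ι ℝ))⁻¹ := by
  simp only [Matrix.inv_def, Ring.inverse_eq_inv']
  have h1 : Continuous fun p => A p + ρ • (1 : Matrix ι ι ℝ) := by fun_prop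
  exact (h1.matrix_det.inv₀ fun p => (posDef_add_smul (hb p) hρ).det_pos.ne').smul
    h1.matrix_adjugate

theorem continuous_gaussWeight {X : Type*} [TopologicalSpace X] {ι : Type*} [Fintype ι]
    [DecidableEq ι] {A : X → Matrix ι ι ℝ} (hA : Continuous A) {ρ r : ℝ} (hρ : 0 < ρ)
    (hb : ∀ p, QuadBdd (A p) r) {x : X → ι → ℝ} (hx : Continuous x) :
    Continuous fun p => gaussWeight (A p + ρ • 1) (x p) := by
  unfold gaussWeight
  have h1 : Continuous fun p => A p + ρ • (1 : Matrix ι ι ℝ) := by fun_prop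
  have h2 := continuous_inv_add_smul hA hρ hb
  have h3 := (h2.matrix_mulVec hx)
  have h4 : Continuous fun p => x p ⬝ᵥ (A p + ρ • (1 : Matrix ι ι ℝ))⁻¹ *ᵥ x p :=
    hx.dotProduct h3
  exact ((Real.continuous_sqrt.comp h1.matrix_det).inv₀ fun p =>
    (Real.sqrt_pos.2 (posDef_add_smul (hb p) hρ).det_pos).ne').mul
    (Real.continuous_exp.comp (h4.neg.div_const 2))

theorem exists_locState_step (hZ : GenericAvoidance Z k) {ρ W : ℝ} (hρ : 0 < ρ) (hρ1 : ρ < 1)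
    (hW : 0 < W) (hM : 0 < M) (z : J → Fin M → ℝ) {a : J → Z → ℝ} (ha : ∀ j, Continuous (a j))
    (ha0 : ∀ j p, 0 ≤ a j p) :
    ∃ C : ℝ, 0 ≤ C ∧ ∃ h₀ > 0, ∀ h, 0 < h → h < h₀ → ∀ (m : Z → Fin M → ℝ)
      (A : Z → Matrix (Fin M) (Fin M) ℝ) (c : ℝ), c ≤ 3 → IsLocState ρ W z a m A c →
      ∀ U : Matrix (Fin M) (Fin (k + 1)) ℝ, (∀ w, U *ᵥ w ⬝ᵥ U *ᵥ w = w ⬝ᵥ w) →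
      ∃ (m' : Z → Fin M → ℝ) (A' : Z → Matrix (Fin M) (Fin M) ℝ),
        IsLocState ρ W z a m' A' (c + C * h ^ 3) ∧ ∀ p, ∃ w : Fin (k + 1) → ℝ, w ⬝ᵥ w = 1 ∧
          A' p = A p - Matrix.vecMulVec (h • A p *ᵥ (U *ᵥ w)) (h • A p *ᵥ (U *ᵥ w)) := by
  set B : ℝ := Real.sqrt (2 * (∑ j, z j ⬝ᵥ z j) + 6 * M) with hB
  have hzsum : 0 ≤ ∑ j, z j ⬝ᵥ z j := Finset.sum_nonneg fun j _ => dotProduct_self_nonneg' _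
  have hB2 : B ^ 2 = 2 * (∑ j, z j ⬝ᵥ z j) + 6 * M := Real.sq_sqrt (by positivity)
  have hB0 : 0 ≤ B := Real.sqrt_nonneg _
  set K : ℝ := (B + 1) / ρ with hK
  have hK0 : 0 < K := by positivity
  refine ⟨1 + 36 * K ^ 3, by positivity, min 1 (1 / (4 * K)), by positivity, ?_⟩
  intro h hh hh0 m A c hc hst U hU
  have hh1 : h ≤ 1 := hh0.le.trans (min_le_left _ _)
  have hhK : h * K ≤ 1 / 4 := by
    have := hh0.le.trans (min_le_right _ _)
    rw [le_div_iff₀ (by positivity)] at this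
    linarith
  obtain ⟨hm, hA, hb, hp⟩ := hst
  have hMpos : (0 : ℝ) < M := by exact_mod_cast hM
  have hmass0 : ∀ p, 0 ≤ (∑ j, a j p * gaussWeight (A p + ρ • 1) (z j - m p)) / W := fun p =>
    div_nonneg (Finset.sum_nonneg fun j _ => mul_nonneg (ha0 j p) (gaussWeight_nonneg _ _)) hW.le
  have hmass : ∀ p, (∑ j, a j p * gaussWeight (A p + ρ • 1) (z j - m p)) / W ≤ 3 := by
    intro p
    have h1 := hp p
    unfold locPotential at h1
    have h2 : 0 ≤ (m p ⬝ᵥ m p + (A p).trace) / M :=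
      div_nonneg (add_nonneg (dotProduct_self_nonneg' _) (hb p).trace_nonneg) hMpos.le
    linarith
  have hmm : ∀ p, m p ⬝ᵥ m p ≤ 3 * M := by
    intro p
    have h1 := hp p
    unfold locPotential at h1
    have h2 : (m p ⬝ᵥ m p + (A p).trace) / M ≤ 3 := by linarith [hmass0 p]
    rw [div_le_iff₀ hMpos] at h2
    linarith [(hb p).trace_nonneg]
  have hx : ∀ p j, (z j - m p) ⬝ᵥ (z j - m p) ≤ B ^ 2 := by
    intro p j
    have h1 : z j ⬝ᵥ z j ≤ ∑ j, z j ⬝ᵥ z j :=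
      Finset.single_le_sum (f := fun j => z j ⬝ᵥ z j) (fun i _ => dotProduct_self_nonneg' _)
        (Finset.mem_univ j)
    have h2 := dotProduct_self_nonneg' (z j + m p)
    have h3 := hmm p
    simp only [add_dotProduct, dotProduct_add, sub_dotProduct, dotProduct_sub] at h2 ⊢
    rw [hB2]
    linarith
  set y : Z → Fin M → ℝ := fun p => W⁻¹ • (∑ j, (a j p * gaussWeight (A p + ρ • 1) (z j - m p)) •
    (A p + ρ • 1)⁻¹ *ᵥ (z j - m p)) + (2 / (M : ℝ)) • m p with hy
  have hyc : Continuous y := by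
    have h1 := continuous_inv_add_smul hA hρ hb
    have h2 : ∀ j, Continuous fun p => z j - m p := fun j => by fun_prop
    have h3 : Continuous fun p => ∑ j, (a j p * gaussWeight (A p + ρ • 1) (z j - m p)) •
        (A p + ρ • 1)⁻¹ *ᵥ (z j - m p) := continuous_finsetSum _ fun j _ =>
      ((ha j).mul (continuous_gaussWeight hA hρ hb (h2 j))).smul (h1.matrix_mulVec (h2 j))
    exact (h3.fun_const_smul _).add (hm.fun_const_smul _)
  set g : Z → Fin (k + 1) → ℝ := fun p => Uᵀ *ᵥ (A p *ᵥ y p) with hg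
  have hgc : Continuous g := continuous_const.matrix_mulVec (hA.matrix_mulVec hyc)
  obtain ⟨w, hwc, hw1, hwg⟩ := hZ.exists_unit hgc (η := h ^ 2) (by positivity)
  set u : Z → Fin M → ℝ := fun p => U *ᵥ w p with hu
  have huc : Continuous u := continuous_const.matrix_mulVec hwc
  have hu1 : ∀ p, u p ⬝ᵥ u p = 1 := fun p => (hU _).trans (hw1 p)
  have hvc : Continuous fun p => h • A p *ᵥ u p := (hA.matrix_mulVec huc).const_smul h
  have huy : ∀ p, (h • A p *ᵥ u p) ⬝ᵥ y p ≤ h ^ 3 := by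
    intro p
    have h1 : (A p *ᵥ u p) ⬝ᵥ y p = w p ⬝ᵥ g p := by
      change (A p *ᵥ (U *ᵥ w p)) ⬝ᵥ y p = w p ⬝ᵥ Uᵀ *ᵥ (A p *ᵥ y p)
      rw [dotProduct_comm, dotProduct_mulVec_symm (hb p).symm,
        Matrix.mulVec_transpose, dotProduct_comm (w p), ← Matrix.dotProduct_mulVec,
        dotProduct_comm]
    rw [smul_dotProduct, smul_eq_mul, h1]
    nlinarith [hwg p]
  refine ⟨fun p => m p + h • A p *ᵥ u p,
    fun p => A p - Matrix.vecMulVec (h • A p *ᵥ u p) (h • A p *ᵥ u p), ⟨hm.add hvc, ?_, ?_, ?_⟩, ?_⟩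
  · exact hA.sub (hvc.matrix_vecMulVec hvc)
  · exact fun p => (hb p).sub_vecMulVec (by linarith) hh.le hh1 (hu1 p)
  · intro p
    have h1 := hp p
    unfold locPotential at h1 ⊢
    set v := h • A p *ᵥ u p with hv
    have hstep : ∀ j, a j p * gaussWeight (A p - Matrix.vecMulVec v v + ρ • 1) (z j - (m p + v)) ≤
        a j p * gaussWeight (A p + ρ • 1) (z j - m p) * (1 + 12 * (h * K) ^ 3) +
        v ⬝ᵥ ((a j p * gaussWeight (A p + ρ • 1) (z j - m p)) •
          (A p + ρ • 1)⁻¹ *ᵥ (z j - m p)) := by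
      intro j
      have := gaussWeight_step_le (hb p) (by linarith) hρ hρ1 hh.le hB0 hhK (hu1 p) (hx p j)
      rw [← sub_sub, dotProduct_smul, smul_eq_mul]
      calc _ ≤ a j p * _ := mul_le_mul_of_nonneg_left this (ha0 j p)
        _ = _ := by ring
    have hsum := Finset.sum_le_sum fun j (_ : j ∈ Finset.univ) => hstep j
    rw [Finset.sum_add_distrib, ← Finset.sum_mul, ← dotProduct_sum] at hsum
    have hsum2 := div_le_div_of_nonneg_right hsum hW.le
    have htr : (A p - Matrix.vecMulVec v v).trace = (A p).trace - v ⬝ᵥ v := by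
      rw [Matrix.trace_sub, Matrix.trace_vecMulVec]
    have hlin := huy p
    simp only [hy, dotProduct_add, dotProduct_smul, smul_eq_mul] at hlin
    have hq : ((m p + v) ⬝ᵥ (m p + v) + (A p - Matrix.vecMulVec v v).trace) / M =
        (m p ⬝ᵥ m p + (A p).trace) / M + 2 / M * (v ⬝ᵥ m p) := by
      rw [htr]
      simp only [add_dotProduct, dotProduct_add, dotProduct_comm (m p) v]
      ring
    rw [hq]
    have h3 := hmass p
    have h4 : (h * K) ^ 3 * ((∑ j, a j p * gaussWeight (A p + ρ • 1) (z j - m p)) / W) ≤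
      (h * K) ^ 3 * 3 := mul_le_mul_of_nonneg_left h3 (by positivity)
    set X := ∑ j, a j p * gaussWeight (A p + ρ • 1) (z j - m p)
    rw [← hv] at hlin
    rw [add_div, mul_div_right_comm, div_eq_inv_mul (v ⬝ᵥ _) W] at hsum2
    nlinarith
  · exact fun p => ⟨w p, hw1 p, rfl⟩

end LocalizationStep

section LocalizationLimit
open scoped Matrix

section Steps
variable {Z J : Type*} [TopologicalSpace Z] [Fintype J] {M k : ℕ}

/-- A localization step with step size `h`, increasing the potential by at most `D`, is available
along every orthonormal `(k + 1)`-frame. -/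
def HasLocSteps (k : ℕ) (ρ W : ℝ) (z : J → Fin M → ℝ) (a : J → Z → ℝ) (h D : ℝ) : Prop :=
  ∀ (m : Z → Fin M → ℝ) (A : Z → Matrix (Fin M) (Fin M) ℝ) (c : ℝ), c ≤ 3 →
    IsLocState ρ W z a m A c → ∀ U : Matrix (Fin M) (Fin (k + 1)) ℝ,
    (∀ w, U *ᵥ w ⬝ᵥ U *ᵥ w = w ⬝ᵥ w) →
    ∃ (m' : Z → Fin M → ℝ) (A' : Z → Matrix (Fin M) (Fin M) ℝ),
      IsLocState ρ W z a m' A' (c + D) ∧ ∀ p, ∃ w : Fin (k + 1) → ℝ, w ⬝ᵥ w = 1 ∧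
        A' p = A p - Matrix.vecMulVec (h • A p *ᵥ (U *ᵥ w)) (h • A p *ᵥ (U *ᵥ w))

variable {ρ W : ℝ} {z : J → Fin M → ℝ} {a : J → Z → ℝ} {h D : ℝ}

theorem HasLocSteps.iterate (H : HasLocSteps k ρ W z a h D) (hD : 0 ≤ D) {σ : ℝ} (hσ : 0 ≤ σ)
    {U : Matrix (Fin M) (Fin (k + 1)) ℝ} (hU : ∀ w, U *ᵥ w ⬝ᵥ U *ᵥ w = w ⬝ᵥ w)
    {m : Z → Fin M → ℝ} {A : Z → Matrix (Fin M) (Fin M) ℝ} {c : ℝ}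
    (hst : IsLocState ρ W z a m A c) (n : ℕ) (hc : c + n * D ≤ 3) :
    ∃ (m' : Z → Fin M → ℝ) (A' : Z → Matrix (Fin M) (Fin M) ℝ),
      IsLocState ρ W z a m' A' (c + n * D) ∧ (∀ p x, x ⬝ᵥ A' p *ᵥ x ≤ x ⬝ᵥ A p *ᵥ x) ∧
      ∀ p, (∃ w : Fin (k + 1) → ℝ, w ⬝ᵥ w = 1 ∧ U *ᵥ w ⬝ᵥ A' p *ᵥ (U *ᵥ w) ≤ σ) ∨
        (A' p).trace ≤ (A p).trace - n * (h ^ 2 * σ ^ 2) := by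
  induction n with
  | zero => exact ⟨m, A, by simpa using hst, fun _ _ => le_rfl, fun _ => Or.inr (by simp)⟩
  | succ n ih =>
    push_cast at hc
    obtain ⟨m₁, A₁, hst₁, hle, halt⟩ := ih (by nlinarith)
    obtain ⟨m₂, A₂, hst₂, hA₂⟩ := H m₁ A₁ _ (by nlinarith) hst₁ U hU
    have hform : ∀ p x, x ⬝ᵥ A₂ p *ᵥ x ≤ x ⬝ᵥ A₁ p *ᵥ x := by
      intro p x
      obtain ⟨w, -, hw⟩ := hA₂ p
      rw [hw, Matrix.sub_mulVec, Matrix.vecMulVec_mulVec, dotProduct_sub]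
      simp only [op_smul_eq_smul, dotProduct_smul, smul_eq_mul]
      rw [dotProduct_comm _ x, dotProduct_smul, smul_eq_mul]
      linarith [mul_self_nonneg (h * x ⬝ᵥ A₁ p *ᵥ U *ᵥ w)]
    refine ⟨m₂, A₂, ?_, fun p x => (hform p x).trans (hle p x), fun p => ?_⟩
    · convert hst₂ using 1
      push_cast
      ring
    · rcases halt p with ⟨w, hw1, hw2⟩ | htr
      · exact Or.inl ⟨w, hw1, (hform p _).trans hw2⟩
      · obtain ⟨w, hw1, hw⟩ := hA₂ p
        rcases le_or_gt (U *ᵥ w ⬝ᵥ A₁ p *ᵥ (U *ᵥ w)) σ with hs | hs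
        · exact Or.inl ⟨w, hw1, (hform p _).trans hs⟩
        · right
          have h1 := dotProduct_sq_le (U *ᵥ w) (A₁ p *ᵥ (U *ᵥ w))
          rw [hU, hw1, one_mul] at h1
          have h2 : σ ^ 2 ≤ A₁ p *ᵥ (U *ᵥ w) ⬝ᵥ A₁ p *ᵥ (U *ᵥ w) :=
            le_trans (by gcongr) h1
          rw [hw, Matrix.trace_sub, Matrix.trace_vecMulVec, smul_dotProduct, dotProduct_smul,
            smul_eq_mul, smul_eq_mul]
          push_cast
          nlinarith [sq_nonneg h]

theorem QuadBdd.trace_le {ι : Type*} [Fintype ι] [DecidableEq ι] {A : Matrix ι ι ℝ} {r : ℝ}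
    (hA : QuadBdd A r) : A.trace ≤ r * Fintype.card ι := by
  have : ∀ i ∈ Finset.univ, A i i ≤ r := fun i _ => by simpa using hA.le (Pi.single i 1)
  have h := Finset.sum_le_card_nsmul _ _ _ this
  rw [nsmul_eq_mul, mul_comm] at h
  exact h

theorem HasLocSteps.iterate_list (H : HasLocSteps k ρ W z a h D) (hD : 0 ≤ D) (hρ : 0 < ρ)
    (hM : 0 < M) {σ : ℝ} (hσ : 0 ≤ σ) {n : ℕ} (hn : M ≤ n * (h ^ 2 * σ ^ 2))
    {m : Z → Fin M → ℝ} {A : Z → Matrix (Fin M) (Fin M) ℝ} {c : ℝ}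
    (hst : IsLocState ρ W z a m A c) (l : List (Matrix (Fin M) (Fin (k + 1)) ℝ))
    (hl : ∀ U ∈ l, ∀ w, U *ᵥ w ⬝ᵥ U *ᵥ w = w ⬝ᵥ w) (hc : c + l.length * (n * D) ≤ 3) :
    ∃ (m' : Z → Fin M → ℝ) (A' : Z → Matrix (Fin M) (Fin M) ℝ),
      IsLocState ρ W z a m' A' (c + l.length * (n * D)) ∧
      ∀ U ∈ l, ∀ p, ∃ w : Fin (k + 1) → ℝ, w ⬝ᵥ w = 1 ∧ U *ᵥ w ⬝ᵥ A' p *ᵥ (U *ᵥ w) ≤ σ := by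
  induction l with
  | nil => exact ⟨m, A, by simpa using hst, by simp⟩
  | cons U l ih =>
    rw [List.length_cons] at hc ⊢
    push_cast at hc
    have hnD : 0 ≤ n * D := by positivity
    obtain ⟨m₁, A₁, hst₁, halt₁⟩ := ih (fun V hV => hl V (List.mem_cons_of_mem _ hV)) (by linarith)
    obtain ⟨m₂, A₂, hst₂, hle, halt⟩ := H.iterate hD hσ (hl U List.mem_cons_self) hst₁ n
      (by linarith)
    refine ⟨m₂, A₂, ?_, fun V hV p => ?_⟩
    · convert hst₂ using 1
      push_cast
      ring
    · rcases List.mem_cons.1 hV with rfl | hV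
      · rcases halt p with h1 | h1
        · exact h1
        · have h2 := (hst₁.bdd p).trace_le
          have h3 := (hst₂.bdd p).trace_nonneg
          rw [Fintype.card_fin] at h2
          have : (0 : ℝ) < M := by exact_mod_cast hM
          nlinarith
      · obtain ⟨w, hw1, hw2⟩ := halt₁ V hV p
        exact ⟨w, hw1, (hle p _).trans hw2⟩

end Steps

theorem exists_finite_frame_net (M k : ℕ) {σ : ℝ} (hσ : 0 < σ) :
    ∃ l : List (Matrix (Fin M) (Fin (k + 1)) ℝ), (∀ U ∈ l, ∀ w, U *ᵥ w ⬝ᵥ U *ᵥ w = w ⬝ᵥ w) ∧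
      ∀ V : Matrix (Fin M) (Fin (k + 1)) ℝ, (∀ w, V *ᵥ w ⬝ᵥ V *ᵥ w = w ⬝ᵥ w) →
        ∃ U ∈ l, ∀ w, w ⬝ᵥ w = 1 → (V *ᵥ w - U *ᵥ w) ⬝ᵥ (V *ᵥ w - U *ᵥ w) ≤ σ := by
  let s : Set (Fin M → Fin (k + 1) → ℝ) :=
    {U | ∀ w, Matrix.of U *ᵥ w ⬝ᵥ Matrix.of U *ᵥ w = w ⬝ᵥ w}
  have hs : TotallyBounded s := by
    refine (isCompact_closedBall (0 : Fin M → Fin (k + 1) → ℝ) 1).totallyBounded.subset ?_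
    intro U hU
    rw [mem_closedBall_zero_iff, pi_norm_le_iff_of_nonneg zero_le_one]
    intro i
    rw [pi_norm_le_iff_of_nonneg zero_le_one]
    intro l
    have h1 := hU (Pi.single l 1)
    simp only [Matrix.mulVec_single_one, dotProduct_single, Pi.single_eq_same, mul_one] at h1
    rw [Real.norm_eq_abs, ← sq_le_one_iff_abs_le_one, ← h1, sq]
    exact Finset.single_le_sum (f := fun i => U i l * U i l) (fun i _ => mul_self_nonneg _)
      (Finset.mem_univ i)
  set δ : ℝ := Real.sqrt (σ / (M * (k + 1) + 1)) with hδ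
  have hδ0 : 0 < δ := by positivity
  have hδ2 : δ ^ 2 = σ / (M * (k + 1) + 1) := Real.sq_sqrt (by positivity)
  obtain ⟨t, hts, htf, htc⟩ := Metric.finite_approx_of_totallyBounded hs δ hδ0
  refine ⟨htf.toFinset.toList.map Matrix.of, ?_, ?_⟩
  · intro U hU
    simp only [List.mem_map, Finset.mem_toList, Set.Finite.mem_toFinset] at hU
    obtain ⟨U, hU, rfl⟩ := hU
    exact hts hU
  · intro V hV
    obtain ⟨U, hU, hVU⟩ := Set.mem_iUnion₂.1 (htc (show Matrix.of.symm V ∈ s from hV))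
    refine ⟨Matrix.of U, ?_, fun w hw => ?_⟩
    · simp only [List.mem_map, Finset.mem_toList, Set.Finite.mem_toFinset]
      exact ⟨U, hU, rfl⟩
    · rw [← Matrix.sub_mulVec]
      have hent : ∀ i l, (V - Matrix.of U) i l * (V - Matrix.of U) i l ≤ δ ^ 2 := by
        intro i l
        have h1 := (dist_le_pi_dist (Matrix.of.symm V i) (U i) l).trans
          ((dist_le_pi_dist (Matrix.of.symm V) U i).trans (Metric.mem_ball.1 hVU).le)
        replace h1 : |V i l - U i l| ≤ δ := h1
        change (V i l - U i l) * (V i l - U i l) ≤ _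
        rw [← sq]
        exact sq_le_sq' (by linarith [(abs_le.1 h1).1]) (abs_le.1 h1).2
      have hrow : ∀ i, ((V - Matrix.of U) *ᵥ w) i * ((V - Matrix.of U) *ᵥ w) i ≤
          (k + 1) * δ ^ 2 := by
        intro i
        have h1 := dotProduct_sq_le ((V - Matrix.of U) i) w
        rw [hw, mul_one] at h1
        have h2 : (V - Matrix.of U) i ⬝ᵥ (V - Matrix.of U) i ≤ (k + 1) * δ ^ 2 := by
          have := Finset.sum_le_card_nsmul Finset.univ _ _ fun l _ => hent i l
          rw [nsmul_eq_mul, Finset.card_univ, Fintype.card_fin] at this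
          push_cast at this
          exact this
        rw [← sq]
        exact h1.trans h2
      have := Finset.sum_le_card_nsmul Finset.univ _ _ fun i _ => hrow i
      rw [nsmul_eq_mul, Finset.card_univ, Fintype.card_fin, hδ2] at this
      refine LE.le.trans this ?_
      rw [← mul_assoc, mul_div_assoc', div_le_iff₀ (by positivity)]
      nlinarith

section Spectral
variable {M k : ℕ}

theorem det_le_of_forall_frame {A : Matrix (Fin M) (Fin M) ℝ} {ρ : ℝ} (hρ : 0 < ρ)
    (hρ1 : 2 * ρ ≤ 1) (hA : QuadBdd A (1 - ρ))
    (hV : ∀ V : Matrix (Fin M) (Fin (k + 1)) ℝ, (∀ w, V *ᵥ w ⬝ᵥ V *ᵥ w = w ⬝ᵥ w) →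
      ∃ w : Fin (k + 1) → ℝ, w ⬝ᵥ w = 1 ∧ V *ᵥ w ⬝ᵥ A *ᵥ (V *ᵥ w) ≤ ρ) :
    (A + ρ • (1 : Matrix (Fin M) (Fin M) ℝ)).det ≤ (2 * ρ) ^ (M - k) := by
  have hpd := posDef_add_smul hA hρ
  have hS := hpd.isHermitian
  set S := A + ρ • (1 : Matrix (Fin M) (Fin M) ℝ) with hSdef
  have hSx : ∀ x, x ⬝ᵥ S *ᵥ x = x ⬝ᵥ A *ᵥ x + ρ * (x ⬝ᵥ x) := by
    intro x
    rw [hSdef, Matrix.add_mulVec, Matrix.smul_mulVec, Matrix.one_mulVec, dotProduct_add,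
      dotProduct_smul, smul_eq_mul]
  let b : Fin M → Fin M → ℝ := fun i => (hS.eigenvectorBasis i).ofLp
  have hb : ∀ i j, b i ⬝ᵥ b j = if i = j then 1 else 0 := by
    intro i j
    have := orthonormal_iff_ite.1 hS.eigenvectorBasis.orthonormal j i
    rw [EuclideanSpace.inner_eq_star_dotProduct] at this
    simp only [star_trivial] at this
    rw [this]
    simp [eq_comm]
  have hSb : ∀ i, S *ᵥ b i = hS.eigenvalues i • b i := fun i => hS.mulVec_eigenvectorBasis i
  have hle1 : ∀ i, hS.eigenvalues i ≤ 1 := by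
    intro i
    have h1 := hSx (b i)
    have h2 := hA.le (b i)
    rw [hSb, dotProduct_smul, hb, if_pos rfl, smul_eq_mul] at h1
    rw [hb, if_pos rfl] at h2
    linarith
  have hpos : ∀ i, 0 ≤ hS.eigenvalues i := fun i => (hpd.eigenvalues_pos i).le
  have hcard : (Finset.univ.filter fun i => 2 * ρ < hS.eigenvalues i).card ≤ k := by
    by_contra! hlt
    obtain ⟨T, hT, hTc⟩ := Finset.exists_subset_card_eq (Nat.succ_le_of_lt hlt)
    let e := T.orderEmbOfFin hTc
    have heT : ∀ l, 2 * ρ < hS.eigenvalues (e l) := fun l => by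
      have := hT (T.orderEmbOfFin_mem hTc l)
      simpa using this
    let V : Matrix (Fin M) (Fin (k + 1)) ℝ := Matrix.of fun i l => b (e l) i
    have hVw : ∀ w, V *ᵥ w = ∑ l, w l • b (e l) := by
      intro w
      ext i
      simp [V, Matrix.mulVec, dotProduct, mul_comm]
    have hee : ∀ l l' : Fin (k + 1), b (e l) ⬝ᵥ b (e l') = if l = l' then 1 else 0 := by
      intro l l'
      rw [hb]
      simp
    obtain ⟨w, hw1, hw2⟩ := hV V fun w => by
      rw [hVw, sum_dotProduct]
      simp only [dotProduct_sum, smul_dotProduct, dotProduct_smul, hee, smul_eq_mul, mul_ite,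
        mul_one, mul_zero, Finset.sum_ite_eq, Finset.mem_univ, if_true]
      rfl
    have h1 : V *ᵥ w ⬝ᵥ S *ᵥ (V *ᵥ w) = ∑ l, hS.eigenvalues (e l) * (w l * w l) := by
      rw [hVw, Matrix.mulVec_sum, sum_dotProduct]
      simp only [Matrix.mulVec_smul, hSb, dotProduct_sum, smul_dotProduct, dotProduct_smul, hee,
        smul_eq_mul, mul_ite, mul_one, mul_zero, Finset.sum_ite_eq, Finset.mem_univ, if_true]
      exact Finset.sum_congr rfl fun l _ => by ring
    have h2 : V *ᵥ w ⬝ᵥ V *ᵥ w = w ⬝ᵥ w := by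
      rw [hVw, sum_dotProduct]
      simp only [dotProduct_sum, smul_dotProduct, dotProduct_smul, hee, smul_eq_mul, mul_ite,
        mul_one, mul_zero, Finset.sum_ite_eq, Finset.mem_univ, if_true]
      rfl
    have h3 : 2 * ρ < ∑ l, hS.eigenvalues (e l) * (w l * w l) := by
      have h5 : ∃ l, w l ≠ 0 := by
        by_contra! h0
        simp [dotProduct, h0] at hw1
      obtain ⟨l, hl⟩ := h5
      calc 2 * ρ = ∑ l, 2 * ρ * (w l * w l) := by
            rw [← Finset.mul_sum]
            change _ = 2 * ρ * (w ⬝ᵥ w)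
            rw [hw1, mul_one]
        _ < _ := Finset.sum_lt_sum
            (fun l _ => mul_le_mul_of_nonneg_right (heT l).le (mul_self_nonneg _))
            ⟨l, Finset.mem_univ _, mul_lt_mul_of_pos_right (heT l) (mul_self_pos.2 hl)⟩
    rw [hSx, h2, hw1] at h1
    linarith
  have hdet : S.det = ∏ i, hS.eigenvalues i := by
    simpa using hS.det_eq_prod_eigenvalues
  rw [hdet, ← Finset.prod_filter_mul_prod_filter_not Finset.univ
    fun i => 2 * ρ < hS.eigenvalues i]
  set T := Finset.univ.filter fun i => 2 * ρ < hS.eigenvalues i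
  have hcard2 : M - k ≤ (Finset.univ.filter fun i => ¬ 2 * ρ < hS.eigenvalues i).card := by
    have : T.card + (Finset.univ.filter fun i => ¬ 2 * ρ < hS.eigenvalues i).card = M := by
      rw [Finset.card_filter_add_card_filter_not, Finset.card_univ, Fintype.card_fin]
    omega
  calc _ ≤ 1 * ∏ i ∈ Finset.univ.filter fun i => ¬ 2 * ρ < hS.eigenvalues i, (2 * ρ) := by
        gcongr ?_ * ?_
        · exact Finset.prod_nonneg fun i _ => hpos i
        · exact Finset.prod_le_one (fun i _ => hpos i) fun i _ => hle1 i
        · refine Finset.prod_le_prod (fun i _ => hpos i) fun i hi => ?_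
          simpa using hi
    _ ≤ _ := by
        rw [one_mul, Finset.prod_const]
        exact pow_le_pow_of_le_one (by positivity) hρ1 hcard2

end Spectral

theorem exists_mean_of_genericAvoidance {Z J : Type*} [TopologicalSpace Z] [Fintype J] {M k : ℕ}
    (hZ : GenericAvoidance Z k) {ρ W : ℝ} (hρ : 0 < ρ) (hρ1 : 2 * ρ ≤ 1) (hW : 0 < W) (hM : 0 < M)
    (z : J → Fin M → ℝ) {a : J → Z → ℝ} (ha : ∀ j, Continuous (a j)) (ha0 : ∀ j p, 0 ≤ a j p)
    (hinit : ∀ p, ∑ j, a j p * Real.exp (-(z j ⬝ᵥ z j) / 2) ≤ W) :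
    ∃ F : Z → Fin M → ℝ, Continuous F ∧ (∀ p, F p ⬝ᵥ F p ≤ 3 * M) ∧
      ∀ p, ∑ j, a j p * Real.exp (-((z j - F p) ⬝ᵥ (z j - F p)) / (2 * ρ)) ≤
        3 * W * Real.sqrt ((2 * ρ) ^ (M - k)) := by
  have hMpos : (0 : ℝ) < M := by exact_mod_cast hM
  have hρ1' : ρ < 1 := by linarith
  obtain ⟨C, hC, h₀, hh₀, hstep⟩ := exists_locState_step hZ hρ hρ1' hW hM z ha ha0
  set σ := ρ / 4 with hσ
  have hσ0 : 0 < σ := by positivity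
  obtain ⟨l, hl, hnet⟩ := exists_finite_frame_net M k hσ0
  set G : ℝ := l.length * C * (M / σ ^ 2 + 1) + 1 with hG
  have hG1 : 1 ≤ G := by
    have : 0 ≤ l.length * C * (M / σ ^ 2 + 1) := by positivity
    linarith
  obtain ⟨h, hh, hhlt⟩ := exists_between (show (0 : ℝ) < min h₀ (1 / G) by positivity)
  have hhG : h * G ≤ 1 := by
    have := (hhlt.trans_le (min_le_right _ _)).le
    rwa [le_div_iff₀ (by linarith)] at this
  have hh1 : h ≤ 1 := by nlinarith
  have H : HasLocSteps k ρ W z a h (C * h ^ 3) := fun m A c hc hst U hU =>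
    hstep h hh (hhlt.trans_le (min_le_left _ _)) m A c hc hst U hU
  set n : ℕ := ⌊M / (h ^ 2 * σ ^ 2)⌋₊ + 1 with hn
  have hn1 : (M : ℝ) ≤ n * (h ^ 2 * σ ^ 2) := by
    rw [← div_le_iff₀ (by positivity), hn]
    push_cast
    exact (Nat.lt_floor_add_one _).le
  have hn2 : (n : ℝ) ≤ M / (h ^ 2 * σ ^ 2) + 1 := by
    rw [hn]
    push_cast
    gcongr
    exact Nat.floor_le (by positivity)
  have hgrow : l.length * (n * (C * h ^ 3)) ≤ 1 := by
    have h1 : n * h ^ 3 ≤ h * (M / σ ^ 2 + 1) := by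
      calc n * h ^ 3 ≤ (M / (h ^ 2 * σ ^ 2) + 1) * h ^ 3 := by gcongr
        _ = h * (M / σ ^ 2 + h ^ 2) := by field_simp
        _ ≤ _ := by
          gcongr
          nlinarith
    calc _ = l.length * C * (n * h ^ 3) := by ring
      _ ≤ l.length * C * (h * (M / σ ^ 2 + 1)) := by gcongr
      _ = h * (G - 1) := by rw [hG]; ring
      _ ≤ _ := by nlinarith
  have hst0 : IsLocState ρ W z a (fun _ => 0) (fun _ => (1 - ρ) • 1) 2 := by
    refine ⟨continuous_const, continuous_const, fun p => ⟨?_, fun x => ?_, fun x => ?_⟩,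
      fun p => ?_⟩
    · simp
    · rw [Matrix.smul_mulVec, Matrix.one_mulVec, dotProduct_smul, smul_eq_mul]
      exact mul_nonneg (by linarith) (dotProduct_self_nonneg' x)
    · rw [Matrix.smul_mulVec, Matrix.one_mulVec, dotProduct_smul, smul_eq_mul]
    · have h1 : (1 - ρ) • (1 : Matrix (Fin M) (Fin M) ℝ) + ρ • 1 = 1 := by
        rw [← add_smul]
        simp
      have h2 : ∀ x : Fin M → ℝ, gaussWeight 1 x = Real.exp (-(x ⬝ᵥ x) / 2) := by
        intro x
        simp [gaussWeight]
      simp only [locPotential, h1, h2, sub_zero, Matrix.trace_smul, Matrix.trace_one,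
        Fintype.card_fin, dotProduct_zero, zero_add, smul_eq_mul]
      rw [mul_div_assoc, div_self hMpos.ne', mul_one]
      have := (div_le_one hW).2 (hinit p)
      linarith
  obtain ⟨m, A, hst, hfr⟩ := H.iterate_list (by positivity) hρ hM hσ0.le hn1 hst0 l hl
    (by linarith)
  have hpot : ∀ p, locPotential ρ W z a m A p ≤ 3 := fun p => (hst.pot_le p).trans (by linarith)
  have hmass0 : ∀ p, 0 ≤ (∑ j, a j p * gaussWeight (A p + ρ • 1) (z j - m p)) / W := fun p =>
    div_nonneg (Finset.sum_nonneg fun j _ => mul_nonneg (ha0 j p) (gaussWeight_nonneg _ _)) hW.le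
  refine ⟨m, hst.cont_mean, fun p => ?_, fun p => ?_⟩
  · have h1 := hpot p
    unfold locPotential at h1
    have h2 : (m p ⬝ᵥ m p + (A p).trace) / M ≤ 3 := by linarith [hmass0 p]
    rw [div_le_iff₀ hMpos] at h2
    linarith [(hst.bdd p).trace_nonneg]
  · have hA := hst.bdd p
    have hdet : (A p + ρ • (1 : Matrix (Fin M) (Fin M) ℝ)).det ≤ (2 * ρ) ^ (M - k) := by
      refine det_le_of_forall_frame hρ hρ1 hA fun V hV => ?_
      obtain ⟨U, hU, hVU⟩ := hnet V hV
      obtain ⟨w, hw1, hw2⟩ := hfr U hU p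
      refine ⟨w, hw1, ?_⟩
      have h1 := hA.nonneg (U *ᵥ w - (V *ᵥ w - U *ᵥ w))
      have h2 := hA.le (V *ᵥ w - U *ᵥ w)
      have h3 := hVU w hw1
      have h4 := dotProduct_self_nonneg' (V *ᵥ w - U *ᵥ w)
      have h5 := dotProduct_mulVec_symm hA.symm (U *ᵥ w) (V *ᵥ w)
      have h6 : (V *ᵥ w - U *ᵥ w) ⬝ᵥ A p *ᵥ (V *ᵥ w - U *ᵥ w) ≤ σ := by nlinarith
      simp only [Matrix.mulVec_sub, dotProduct_sub, sub_dotProduct] at h1 h6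
      linarith
    have h1 := hpot p
    unfold locPotential at h1
    have h2 : 0 ≤ (m p ⬝ᵥ m p + (A p).trace) / M :=
      div_nonneg (add_nonneg (dotProduct_self_nonneg' _) hA.trace_nonneg) hMpos.le
    have h3 : ∑ j, a j p * gaussWeight (A p + ρ • 1) (z j - m p) ≤ 3 * W := by
      rw [← div_le_iff₀ hW]
      linarith
    have hdpos := (posDef_add_smul hA hρ).det_pos
    have hs : 0 < Real.sqrt ((2 * ρ) ^ (M - k)) := by positivity
    have h4 : ∀ x : Fin M → ℝ, Real.exp (-(x ⬝ᵥ x) / (2 * ρ)) ≤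
        gaussWeight (A p + ρ • 1) x * Real.sqrt ((2 * ρ) ^ (M - k)) := by
      intro x
      rw [gaussWeight, mul_right_comm, ← div_eq_inv_mul]
      have h5 : 1 ≤ Real.sqrt ((2 * ρ) ^ (M - k)) / Real.sqrt (A p + ρ • 1).det := by
        rw [one_le_div (Real.sqrt_pos.2 hdpos)]
        exact Real.sqrt_le_sqrt hdet
      obtain ⟨-, h6, -⟩ := hA.inv_bounds hρ x
      have h7 : Real.exp (-(x ⬝ᵥ x) / (2 * ρ)) ≤
          Real.exp (-(x ⬝ᵥ (A p + ρ • (1 : Matrix (Fin M) (Fin M) ℝ))⁻¹ *ᵥ x) / 2) := by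
        apply Real.exp_le_exp.2
        rw [div_le_div_iff₀ (by positivity) (by norm_num)]
        nlinarith
      exact h7.trans (le_mul_of_one_le_left (Real.exp_pos _).le h5)
    calc _ ≤ ∑ j, a j p * (gaussWeight (A p + ρ • 1) (z j - m p) *
          Real.sqrt ((2 * ρ) ^ (M - k))) :=
          Finset.sum_le_sum fun j _ => mul_le_mul_of_nonneg_left (h4 _) (ha0 j p)
      _ = (∑ j, a j p * gaussWeight (A p + ρ • 1) (z j - m p)) *
          Real.sqrt ((2 * ρ) ^ (M - k)) := by
          rw [Finset.sum_mul]
          exact Finset.sum_congr rfl fun j _ => by ring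
      _ ≤ _ := by gcongr

end LocalizationLimit

section GeneralPosition

theorem GenericAvoidance.of_dimH_le {Z E : Type*} [TopologicalSpace Z] [NormedAddCommGroup E]
    [NormedSpace ℝ E] [FiniteDimensional ℝ E] {e : Z → E} (he : IsClosedEmbedding e) {k : ℕ}
    (hk : dimH (Set.range e) ≤ k) : GenericAvoidance Z k := by
  intro g hg η hη
  obtain ⟨G, hG⟩ := ContinuousMap.exists_extension he ⟨g, hg⟩
  have hGe : ∀ p, G (e p) = g p := fun p => DFunLike.congr_fun hG p
  obtain ⟨g₁, hg₁, hd, -⟩ := G.continuous.exists_contDiff_approx 1 (ε := fun _ => η / 2)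
    continuous_const fun _ => by positivity
  have hdim : dimH (g₁ '' Set.range e) < (Module.finrank ℝ (Fin (k + 1) → ℝ) : ℝ≥0∞) := by
    refine (hg₁.contDiffOn.dimH_image_le convex_univ (Set.subset_univ _)).trans_lt
      (hk.trans_lt ?_)
    rw [Module.finrank_fin_fun]
    exact_mod_cast Nat.lt_succ_self k
  obtain ⟨c, hc, hcd⟩ := (dense_compl_of_dimH_lt_finrank hdim).exists_dist_lt 0
    (half_pos hη)
  refine ⟨fun p => g₁ (e p) - c, (hg₁.continuous.comp he.continuous).sub continuous_const,
    fun p h0 => hc ⟨e p, Set.mem_range_self p, sub_eq_zero.1 h0⟩, fun p => ?_⟩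
  rw [← hGe]
  calc dist (g₁ (e p) - c) (G (e p)) ≤ dist (g₁ (e p) - c) (g₁ (e p)) + dist (g₁ (e p)) (G (e p)) :=
        dist_triangle _ _ _
    _ ≤ η / 2 + η / 2 := by
        gcongr
        · rw [dist_comm] at hcd
          simpa [dist_eq_norm] using hcd.le
        · exact (hd _).le
    _ = η := add_halves η

variable {m L : ℕ} {K : Geometry.SimplicialComplex ℝ (Fin m → ℝ)}

theorem isCompact_space (hK : K.faces.Finite) : IsCompact K.space :=
  hK.isCompact_biUnion fun s _ => s.finite_toSet.isCompact_convexHull ℝ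

theorem dimH_pi_convexHull_le {k : ℕ} {s : Fin L → Finset (Fin m → ℝ)}
    (hne : ∀ l, (s l).Nonempty) (hs : ∀ l, (s l).card ≤ k + 1) :
    dimH (Set.univ.pi fun l => convexHull ℝ (s l : Set (Fin m → ℝ))) ≤ (L * k : ℕ) := by
  have hv : ∀ l, ∃ v : Fin (k + 1) → Fin m → ℝ, Set.range v = s l := by
    intro l
    have := (hne l).to_subtype
    obtain ⟨f, hf⟩ : ∃ f : Fin (k + 1) → s l, Function.Surjective f := by
      obtain ⟨e⟩ : Nonempty (s l ↪ Fin (k + 1)) :=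
        Function.Embedding.nonempty_of_card_le (by simpa using hs l)
      exact ⟨Function.invFun e, Function.invFun_surjective e.injective⟩
    refine ⟨fun i => f i, ?_⟩
    rw [Set.range_comp' Subtype.val f, hf.range_eq]
    simp
  choose v hv using hv
  let F : (Fin L × Fin k → ℝ) → Fin L → Fin m → ℝ := fun t l =>
    v l 0 + ∑ j : Fin k, t (l, j) • (v l j.succ - v l 0)
  have hF : ContDiff ℝ 1 F := by
    refine contDiff_pi.2 fun l => contDiff_const.add (ContDiff.sum fun j _ => ?_)
    exact (contDiff_apply ℝ ℝ (l, j)).smul contDiff_const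
  have hsub : (Set.univ.pi fun l => convexHull ℝ (s l : Set (Fin m → ℝ))) ⊆ Set.range F := by
    intro x hx
    have hw : ∀ l, ∃ w : Fin (k + 1) → ℝ, ∑ i, w i = 1 ∧ ∑ i, w i • v l i = x l := by
      intro l
      have h1 := hx l (Set.mem_univ l)
      simp only [← hv l] at h1
      rw [convexHull_range_eq_exists_affineCombination] at h1
      obtain ⟨T, w, hw0, hw1, hw2⟩ := h1
      refine ⟨fun i => if i ∈ T then w i else 0, by simpa using hw1, ?_⟩
      rw [← hw2, Finset.affineCombination_eq_linear_combination _ _ _ hw1]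
      simp
    choose w hw1 hw2 using hw
    refine ⟨fun q => w q.1 q.2.succ, ?_⟩
    ext1 l
    have h1 := hw1 l
    rw [Fin.sum_univ_succ] at h1
    rw [← hw2 l, Fin.sum_univ_succ]
    simp only [F, smul_sub, Finset.sum_sub_distrib, ← Finset.sum_smul]
    rw [show w l 0 = 1 - ∑ j : Fin k, w l j.succ by linarith, sub_smul, one_smul]
    abel
  refine (dimH_mono hsub).trans (hF.dimH_range_le.trans ?_)
  simp

theorem GenericAvoidance.pi_space (hK : K.faces.Finite) {k : ℕ}
    (hk : ∀ s ∈ K.faces, s.card ≤ k + 1) : GenericAvoidance (Fin L → K.space) (L * k) := by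
  have := isCompact_iff_compactSpace.1 (isCompact_space hK)
  let e : (Fin L → K.space) → Fin L → Fin m → ℝ := fun p l => p l
  have he : IsClosedEmbedding e := by
    refine Continuous.isClosedEmbedding (by fun_prop) fun p q h => ?_
    ext1 l
    exact Subtype.ext (congr_fun h l)
  refine .of_dimH_le he ?_
  have hfin : Finite K.faces := hK
  have hsub : Set.range e ⊆ ⋃ σ : Fin L → K.faces,
      Set.univ.pi fun l => convexHull ℝ ((σ l : Finset (Fin m → ℝ)) : Set (Fin m → ℝ)) := by
    rintro _ ⟨p, rfl⟩
    have : ∀ l, ∃ s : K.faces, (p l : Fin m → ℝ) ∈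
        convexHull ℝ ((s : Finset (Fin m → ℝ)) : Set (Fin m → ℝ)) := by
      intro l
      obtain ⟨s, hs, hps⟩ := Set.mem_iUnion₂.1 (p l).2
      exact ⟨⟨s, hs⟩, hps⟩
    choose σ hσ using this
    exact Set.mem_iUnion.2 ⟨σ, fun l _ => hσ l⟩
  refine (dimH_mono hsub).trans ?_
  rw [dimH_iUnion]
  exact iSup_le fun σ => dimH_pi_convexHull_le (fun l => K.nonempty_of_mem_faces (σ l).2)
    fun l => hk _ (σ l).2

end GeneralPosition

section Waist

/-- The folding map `ℝ → [0, 1]`, sending a number to its distance to the even integers. -/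
noncomputable def foldUnit (x : ℝ) : unitInterval :=
  ⟨Real.arccos (Real.cos (Real.pi * x)) / Real.pi,
    div_nonneg (Real.arccos_nonneg _) Real.pi_pos.le,
    (div_le_one Real.pi_pos).2 (Real.arccos_le_pi _)⟩

theorem continuous_foldUnit : Continuous foldUnit := by
  unfold foldUnit
  fun_prop

theorem exists_eq_add_foldUnit (x : ℝ) :
    ∃ (n : ℤ) (b : Bool), x = 2 * n + (if b then 1 else -1) * (foldUnit x : ℝ) := by
  have h1 : Real.cos (Real.pi * (foldUnit x : ℝ)) = Real.cos (Real.pi * x) := by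
    change Real.cos (Real.pi * (Real.arccos (Real.cos (Real.pi * x)) / Real.pi)) = _
    rw [mul_div_cancel₀ _ Real.pi_ne_zero,
      Real.cos_arccos (Real.neg_one_le_cos _) (Real.cos_le_one _)]
  obtain ⟨n, h | h⟩ := Real.cos_eq_cos_iff.1 h1
  · refine ⟨n, true, mul_left_cancel₀ Real.pi_ne_zero ?_⟩
    rw [h]
    simp
    ring
  · refine ⟨n, false, mul_left_cancel₀ Real.pi_ne_zero ?_⟩
    rw [h]
    simp
    ring

theorem exists_gauss_copies_bound :
    ∃ C : ℝ, 1 ≤ C ∧ ∀ (T : Finset ℤ) (b : unitInterval),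
      ∑ n : T × Bool, Real.exp (-((2 * (n.1 : ℤ) + (if n.2 then 1 else -1) * (b : ℝ)) *
        (2 * (n.1 : ℤ) + (if n.2 then 1 else -1) * (b : ℝ))) / 2) ≤ C := by
  have hs : Summable fun n : ℤ => Real.exp (3 / 2) * Real.exp (-(2 * |(n : ℝ)|)) := by
    refine Summable.mul_left _ (Summable.of_nat_of_neg ?_ ?_)
    · simpa [mul_comm] using Real.summable_exp_nat_mul_iff.2 (show (-2 : ℝ) < 0 by norm_num)
    · simpa [mul_comm] using Real.summable_exp_nat_mul_iff.2 (show (-2 : ℝ) < 0 by norm_num)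
  have hle : ∀ (n : ℤ) (c : ℝ), |c| ≤ 1 → Real.exp (-((2 * n + c) * (2 * n + c)) / 2) ≤
      Real.exp (3 / 2) * Real.exp (-(2 * |(n : ℝ)|)) := by
    intro n c hc
    rw [← Real.exp_add]
    apply Real.exp_le_exp.2
    have h1 : 2 * |(n : ℝ)| ≤ |2 * n + c| + |c| := by
      have := abs_sub (2 * (n : ℝ) + c) c
      rwa [add_sub_cancel_right, abs_mul, abs_two] at this
    have h2 := abs_mul_abs_self (2 * (n : ℝ) + c)
    nlinarith [sq_nonneg (|2 * (n : ℝ) + c| - 1)]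
  refine ⟨max 1 (2 * ∑' n : ℤ, Real.exp (3 / 2) * Real.exp (-(2 * |(n : ℝ)|))), le_max_left _ _,
    fun T b => le_max_of_le_right ?_⟩
  have hb : |(b : ℝ)| ≤ 1 := by
    rw [abs_of_nonneg b.2.1]
    exact b.2.2
  calc _ ≤ ∑ n : T × Bool, Real.exp (3 / 2) * Real.exp (-(2 * |((n.1 : ℤ) : ℝ)|)) := by
        refine Finset.sum_le_sum fun n _ => hle _ _ ?_
        rcases n.2 <;> simpa using hb
    _ = 2 * ∑ n ∈ T, Real.exp (3 / 2) * Real.exp (-(2 * |(n : ℝ)|)) := by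
        rw [Fintype.sum_prod_type_right]
        simp only [Fintype.sum_bool]
        rw [← two_mul, Finset.sum_coe_sort T
          fun n : ℤ => Real.exp (3 / 2) * Real.exp (-(2 * |(n : ℝ)|))]
    _ ≤ _ := by
        gcongr
        exact hs.sum_le_tsum _ fun n _ => by positivity

theorem exists_waist_bound :
    ∃ C : ℝ, 1 ≤ C ∧ ∀ {Z : Type} [TopologicalSpace Z] [CompactSpace Z] [T2Space Z] {M k : ℕ},
      GenericAvoidance Z k → ∀ {ε : ℝ}, 0 < ε → 2 * ε ^ 2 ≤ 1 →
      ∀ {f : (Fin M → unitInterval) → Z}, Continuous f → ∀ {A : ℕ}, 1 ≤ A →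
      (∀ p, ∃ B : Finset (Fin M → unitInterval), B.card ≤ A ∧
        ∀ x, f x = p → ∃ b ∈ B, dist x b < ε) →
      (1 / ε) ^ (M - k) ≤ A * C ^ M := by
  obtain ⟨C₀, hC₀, hcopies⟩ := exists_gauss_copies_bound
  refine ⟨3 * C₀ * 2 * Real.exp 1, ?_, ?_⟩
  · have := Real.add_one_le_exp 1
    nlinarith
  intro Z _ _ _ M k hZ ε hε hε2 f hf A hA hB
  have hA1 : (1 : ℝ) ≤ A := by exact_mod_cast hA
  rcases Nat.eq_zero_or_pos M with rfl | hM
  · simpa using hA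
  have hMpos : (0 : ℝ) < M := by exact_mod_cast hM
  have hM1 : (1 : ℝ) ≤ M := by exact_mod_cast hM
  choose B hBA hBf using hB
  -- the neighbourhoods over which the cover of a fibre persists
  have hopen : ∀ p, ∃ U : Set Z, IsOpen U ∧ p ∈ U ∧
      ∀ x, f x ∈ U → ∃ b ∈ B p, dist x b < ε := by
    intro p
    have h1 : IsOpen (⋃ b ∈ B p, Metric.ball b ε) :=
      isOpen_biUnion fun b _ => Metric.isOpen_ball
    have h2 : IsClosed (f '' (⋃ b ∈ B p, Metric.ball b ε)ᶜ) :=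
      (h1.isClosed_compl.isCompact.image hf).isClosed
    refine ⟨(f '' (⋃ b ∈ B p, Metric.ball b ε)ᶜ)ᶜ, h2.isOpen_compl, ?_, ?_⟩
    · rintro ⟨x, hx, hxp⟩
      obtain ⟨b, hb, hxb⟩ := hBf p x hxp
      exact hx (Set.mem_iUnion₂.2 ⟨b, hb, hxb⟩)
    · intro x hx
      by_contra hne
      refine hx ⟨x, fun hmem => hne ?_, rfl⟩
      obtain ⟨b, hb, hxb⟩ := Set.mem_iUnion₂.1 hmem
      exact ⟨b, hb, hxb⟩
  choose U hUo hpU hUB using hopen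
  obtain ⟨T, hT⟩ := isCompact_univ.elim_finite_subcover U hUo
    fun p _ => Set.mem_iUnion.2 ⟨p, hpU p⟩
  obtain ⟨Λ, hΛ⟩ := PartitionOfUnity.exists_isSubordinate isClosed_univ (fun t : T => U t)
    (fun t => hUo t) (by
      intro p hp
      obtain ⟨t, ht, hpt⟩ := Set.mem_iUnion₂.1 (hT hp)
      exact Set.mem_iUnion.2 ⟨⟨t, ht⟩, hpt⟩)
  have hΛ1 : ∀ p, ∑ t, Λ t p = 1 := fun p => by
    rw [← finsum_eq_sum_of_fintype]
    exact Λ.sum_eq_one (Set.mem_univ p)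
  -- the centers and weights
  let S : Finset ℤ := Finset.Icc (-(3 * M + 1 : ℤ)) (3 * M + 1)
  let J := (Σ t : T, B t) × (Fin M → S × Bool)
  let z : J → Fin M → ℝ := fun j i =>
    2 * ((j.2 i).1 : ℤ) + (if (j.2 i).2 then 1 else -1) * ((j.1.2 : Fin M → unitInterval) i : ℝ)
  let a : J → Z → ℝ := fun j p => Λ j.1.1 p
  have ha0 : ∀ j p, 0 ≤ a j p := fun j p => Λ.nonneg _ _
  have hinit : ∀ p, ∑ j, a j p * Real.exp (-(z j ⬝ᵥ z j) / 2) ≤ A * C₀ ^ M := by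
    intro p
    have hone : ∀ b : Fin M → unitInterval, ∑ n : Fin M → S × Bool, ∏ i, Real.exp
        (-((2 * ((n i).1 : ℤ) + (if (n i).2 then 1 else -1) * (b i : ℝ)) *
        (2 * ((n i).1 : ℤ) + (if (n i).2 then 1 else -1) * (b i : ℝ))) / 2) ≤ C₀ ^ M := by
      intro b
      rw [← Fintype.prod_sum fun (i : Fin M) (q : S × Bool) => Real.exp
        (-((2 * (q.1 : ℤ) + (if q.2 then 1 else -1) * (b i : ℝ)) *
        (2 * (q.1 : ℤ) + (if q.2 then 1 else -1) * (b i : ℝ))) / 2)]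
      refine (Finset.prod_le_prod (fun i _ => Finset.sum_nonneg fun q _ => (Real.exp_pos _).le)
        fun i _ => hcopies S (b i)).trans (le_of_eq ?_)
      rw [Finset.prod_const, Finset.card_univ, Fintype.card_fin]
    have hsplit : ∀ j : J, a j p * Real.exp (-(z j ⬝ᵥ z j) / 2) = Λ j.1.1 p * ∏ i, Real.exp
        (-((2 * ((j.2 i).1 : ℤ) + (if (j.2 i).2 then 1 else -1) *
          ((j.1.2 : Fin M → unitInterval) i : ℝ)) * (2 * ((j.2 i).1 : ℤ) +
          (if (j.2 i).2 then 1 else -1) * ((j.1.2 : Fin M → unitInterval) i : ℝ))) / 2) := by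
      intro j
      rw [← Real.exp_sum, ← Finset.sum_div, Finset.sum_neg_distrib]
      rfl
    simp only [hsplit]
    rw [Fintype.sum_prod_type, Fintype.sum_sigma]
    simp only [← Finset.mul_sum]
    calc _ ≤ ∑ t : T, ∑ _b : B t, Λ t p * C₀ ^ M := by
          refine Finset.sum_le_sum fun t _ => ?_
          rw [← Finset.mul_sum]
          exact mul_le_mul_of_nonneg_left (Finset.sum_le_sum fun b _ => hone b) (Λ.nonneg _ _)
      _ ≤ ∑ t : T, Λ t p * (A * C₀ ^ M) := by
          refine Finset.sum_le_sum fun t _ => ?_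
          rw [Finset.sum_const, Finset.card_univ, Fintype.card_coe, nsmul_eq_mul]
          have h1 : ((B t).card : ℝ) ≤ A := by exact_mod_cast hBA t
          have h2 : 0 ≤ Λ t p * C₀ ^ M := mul_nonneg (Λ.nonneg _ _) (by positivity)
          nlinarith
      _ = _ := by rw [← Finset.sum_mul, hΛ1, one_mul]
  obtain ⟨F, hF, hFM, hFs⟩ := exists_mean_of_genericAvoidance hZ (ρ := ε ^ 2) (by positivity) hε2
    (W := A * C₀ ^ M) (by positivity) hM z (fun j => (Λ j.1.1).continuous) ha0 hinit
  -- the fixed point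
  let θ : EuclideanSpace ℝ (Fin M) → Fin M → unitInterval := fun x i => foldUnit (x i)
  have hθ : Continuous θ := continuous_pi fun i => continuous_foldUnit.comp (by fun_prop)
  obtain ⟨x, hx⟩ := exists_fixedPoint_of_bounded
    (G := fun x => WithLp.toLp 2 (F (f (θ x)))) (C := Real.sqrt (3 * M))
    ((PiLp.continuous_toLp 2 _).comp (hF.comp (hf.comp hθ))) fun x => by
      rw [EuclideanSpace.norm_eq]
      refine Real.sqrt_le_sqrt ?_
      refine le_trans (le_of_eq ?_) (hFM (f (θ x)))
      simp only [dotProduct, Real.norm_eq_abs, sq_abs, ← sq]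
  set p := f (θ x) with hp
  have hxF : ∀ i, F p i = x i := fun i => congr_fun (congr_arg WithLp.ofLp hx) i
  have hx2 : ∀ i, |x i| ≤ 3 * M := by
    intro i
    refine abs_le_of_sq_le_sq ?_ (by positivity)
    have h1 : F p i * F p i ≤ F p ⬝ᵥ F p :=
      Finset.single_le_sum (f := fun i => F p i * F p i) (fun i _ => mul_self_nonneg _)
        (Finset.mem_univ i)
    have h2 := hFM p
    rw [hxF] at h1
    nlinarith
  choose n s hns using fun i => exists_eq_add_foldUnit (x i)
  have hnS : ∀ i, n i ∈ S := by
    intro i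
    have h1 : |2 * (n i : ℝ)| ≤ 3 * M + 1 := by
      have h2 : 2 * (n i : ℝ) = x i - (if s i then 1 else -1) * (foldUnit (x i) : ℝ) := by
        linarith [hns i]
      have h3 : |(if s i then 1 else -1) * (foldUnit (x i) : ℝ)| ≤ 1 := by
        have h4 : |(foldUnit (x i) : ℝ)| ≤ 1 := by
          rw [abs_of_nonneg (foldUnit (x i)).2.1]
          exact (foldUnit (x i)).2.2
        rcases s i <;> simpa using h4
      rw [h2]
      exact (abs_sub _ _).trans (add_le_add (hx2 i) h3)
    have h5 : |2 * n i| ≤ 3 * M + 1 := by exact_mod_cast h1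
    simp only [S, Finset.mem_Icc]
    rw [abs_le] at h5
    omega
  have hlow : Real.exp (-M) ≤
      ∑ j, a j p * Real.exp (-((z j - F p) ⬝ᵥ (z j - F p)) / (2 * ε ^ 2)) := by
    let g : (t : T) → B t → (Fin M → S × Bool) → ℝ := fun t b m => a (⟨t, b⟩, m) p *
      Real.exp (-((z (⟨t, b⟩, m) - F p) ⬝ᵥ (z (⟨t, b⟩, m) - F p)) / (2 * ε ^ 2))
    have hg0 : ∀ t b m, 0 ≤ g t b m := fun t b m => mul_nonneg (ha0 _ _) (Real.exp_pos _).le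
    have hterm : ∀ t : T, Λ t p * Real.exp (-M) ≤ ∑ b, ∑ m, g t b m := by
      intro t
      rcases (Λ.nonneg t p).eq_or_lt with h0 | h0
      · rw [← h0, zero_mul]
        exact Finset.sum_nonneg fun b _ => Finset.sum_nonneg fun m _ => hg0 t b m
      · have hpt : p ∈ U t := hΛ t (subset_tsupport _ h0.ne')
        obtain ⟨b, hb, hxb⟩ := hUB t (θ x) hpt
        let m : Fin M → S × Bool := fun i => (⟨n i, hnS i⟩, s i)
        have hz : (z (⟨t, ⟨b, hb⟩⟩, m) - F p) ⬝ᵥ (z (⟨t, ⟨b, hb⟩⟩, m) - F p) ≤ M * ε ^ 2 := by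
          have hcoord : ∀ i ∈ Finset.univ, (z (⟨t, ⟨b, hb⟩⟩, m) - F p) i *
              (z (⟨t, ⟨b, hb⟩⟩, m) - F p) i ≤ ε ^ 2 := by
            intro i _
            have h1 : |(foldUnit (x i) : ℝ) - b i| ≤ ε :=
              ((dist_le_pi_dist (θ x) b i).trans_lt hxb).le
            have h2 : (z (⟨t, ⟨b, hb⟩⟩, m) - F p) i =
                (if s i then 1 else -1) * ((b i : ℝ) - foldUnit (x i)) := by
              rw [Pi.sub_apply, hxF]
              simp only [z, m]
              linarith [hns i]
            have h3 : ((if s i then 1 else -1 : ℝ)) * (if s i then 1 else -1) = 1 := by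
              rcases s i <;> simp
            rw [h2, mul_mul_mul_comm, h3, one_mul, ← abs_mul_abs_self, abs_sub_comm, sq]
            exact mul_self_le_mul_self (abs_nonneg _) h1
          have := Finset.sum_le_card_nsmul _ _ _ hcoord
          rwa [nsmul_eq_mul, Finset.card_univ, Fintype.card_fin] at this
        have h1 : Λ t p * Real.exp (-M) ≤ g t ⟨b, hb⟩ m := by
          refine mul_le_mul_of_nonneg_left (Real.exp_le_exp.2 ?_) h0.le
          rw [le_div_iff₀ (by positivity)]
          nlinarith [mul_pos hMpos (pow_pos hε 2)]
        have h2 : g t ⟨b, hb⟩ m ≤ ∑ m, g t ⟨b, hb⟩ m :=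
          Finset.single_le_sum (fun m _ => hg0 t ⟨b, hb⟩ m) (Finset.mem_univ m)
        have h3 : ∑ m, g t ⟨b, hb⟩ m ≤ ∑ b, ∑ m, g t b m :=
          Finset.single_le_sum (f := fun b => ∑ m, g t b m)
            (fun b _ => Finset.sum_nonneg fun m _ => hg0 t b m) (Finset.mem_univ _)
        exact h1.trans (h2.trans h3)
    rw [Fintype.sum_prod_type, Fintype.sum_sigma]
    calc Real.exp (-M) = ∑ t, Λ t p * Real.exp (-M) := by rw [← Finset.sum_mul, hΛ1, one_mul]
      _ ≤ _ := Finset.sum_le_sum fun t _ => hterm t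
  have hfin := hlow.trans (hFs p)
  have hsqrt : Real.sqrt ((2 * ε ^ 2) ^ (M - k)) ≤ 2 ^ M * ε ^ (M - k) := by
    rw [Real.sqrt_le_left (by positivity), mul_pow, mul_pow, ← pow_mul ε, ← pow_mul ε, ← pow_mul,
      mul_comm 2 (M - k)]
    gcongr
    · norm_num
    · omega
  rw [one_div, inv_pow, inv_le_iff_one_le_mul₀ (by positivity)]
  have h3M : (3 : ℝ) ≤ 3 ^ M := le_self_pow₀ (by norm_num) hM.ne'
  have h1 : Real.exp (-M) ≤ 3 ^ M * (A * C₀ ^ M) * (2 ^ M * ε ^ (M - k)) := by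
    refine hfin.trans ?_
    gcongr
  have h2 : Real.exp (-M) * Real.exp 1 ^ M = 1 := by
    rw [← Real.exp_nat_mul, ← Real.exp_add]
    simp
  calc 1 = Real.exp (-M) * Real.exp 1 ^ M := h2.symm
    _ ≤ 3 ^ M * (A * C₀ ^ M) * (2 ^ M * ε ^ (M - k)) * Real.exp 1 ^ M := by gcongr
    _ = _ := by
      rw [mul_pow, mul_pow, mul_pow]
      ring

end Waist

section DynamicalMetric

theorem lt_of_setEDiam_lt {X : Type*} {ρ : X → X → ℝ} {E : Set X} {ε : ℝ}
    (h : setEDiam ρ E < ENNReal.ofReal ε) {x y : X} (hx : x ∈ E) (hy : y ∈ E) : ρ x y < ε :=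
  (ENNReal.ofReal_lt_ofReal_iff'.1 <| lt_of_le_of_lt
    ((le_iSup₂ (f := fun y (_ : y ∈ E) => ENNReal.ofReal (ρ x y)) y hy).trans
      (le_iSup₂ (f := fun x (_ : x ∈ E) => ⨆ y ∈ E, ENNReal.ofReal (ρ x y)) x hx)) h).1

theorem setEDiam_lt {X : Type*} {ρ : X → X → ℝ} {E : Set X} {r ε : ℝ} (hε : 0 < ε) (hr : r < ε)
    (h : ∀ x ∈ E, ∀ y ∈ E, ρ x y ≤ r) : setEDiam ρ E < ENNReal.ofReal ε :=
  lt_of_le_of_lt (iSup₂_le fun x hx => iSup₂_le fun y hy => ENNReal.ofReal_le_ofReal (h x hx y hy))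
    ((ENNReal.ofReal_lt_ofReal_iff hε).2 hr)

theorem dynDist_set_finite {X : Type*} (T : X → X) (d : X → X → ℝ) (N : ℕ) (x y : X) :
    {r : ℝ | ∃ n, n < N ∧ r = d (T^[n] x) (T^[n] y)}.Finite := by
  refine ((Finset.range N).finite_toSet.image fun n => d (T^[n] x) (T^[n] y)).subset ?_
  rintro r ⟨n, hn, rfl⟩
  exact ⟨n, by simpa using hn, rfl⟩

theorem le_dynDist {X : Type*} (T : X → X) (d : X → X → ℝ) {N n : ℕ} (hn : n < N) (x y : X) :
    d (T^[n] x) (T^[n] y) ≤ dynDist T d N x y :=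
  le_csSup (dynDist_set_finite T d N x y).bddAbove ⟨n, hn, rfl⟩

theorem dynDist_le {X : Type*} {T : X → X} {d : X → X → ℝ} {N : ℕ} {x y : X} {r : ℝ} (hr : 0 ≤ r)
    (h : ∀ n < N, d (T^[n] x) (T^[n] y) ≤ r) : dynDist T d N x y ≤ r :=
  Real.sSup_le (by rintro _ ⟨n, hn, rfl⟩; exact h n hn) hr

theorem dynDist_lt {X : Type*} {T : X → X} {d : X → X → ℝ} {N : ℕ} {x y : X} {r : ℝ} (hr : 0 < r)
    (h : ∀ n < N, d (T^[n] x) (T^[n] y) < r) : dynDist T d N x y < r := by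
  rcases {r : ℝ | ∃ n, n < N ∧ r = d (T^[n] x) (T^[n] y)}.eq_empty_or_nonempty with he | hne
  · rw [dynDist, he, Real.sSup_empty]
    exact hr
  · exact ((dynDist_set_finite T d N x y).csSup_lt_iff hne).2
      (by rintro _ ⟨n, hn, rfl⟩; exact h n hn)

variable {X : Type*} [PseudoMetricSpace X] {T : X → X}

theorem isOpen_dynBall (hT : Continuous T) (N : ℕ) (x : X) (r : ℝ) :
    IsOpen {y | ∀ n < N, dist (T^[n] x) (T^[n] y) < r} := by
  have : {y | ∀ n < N, dist (T^[n] x) (T^[n] y) < r} =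
      ⋂ n ∈ Finset.range N, {y | dist (T^[n] x) (T^[n] y) < r} := by
    ext y
    simp
  rw [this]
  exact isOpen_biInter_finset fun n _ =>
    isOpen_lt (continuous_const.dist (hT.iterate n)) continuous_const

theorem ROpen.isOpen (hT : Continuous T) {N : ℕ} {U : Set X} (hU : ROpen (dynDist T dist N) U) :
    IsOpen U := by
  refine isOpen_iff_mem_nhds.2 fun x hx => ?_
  obtain ⟨δ, hδ, h⟩ := hU x hx
  refine mem_of_superset ((isOpen_dynBall hT N x δ).mem_nhds ?_) fun y hy => h y (dynDist_lt hδ hy)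
  intro n _
  rwa [dist_self]

theorem IsOpen.rOpen_dynDist {N : ℕ} (hN : 0 < N) {U : Set X} (hU : IsOpen U) :
    ROpen (dynDist T dist N) U := by
  intro x hx
  obtain ⟨δ, hδ, h⟩ := Metric.isOpen_iff.1 hU x hx
  refine ⟨δ, hδ, fun y hy => h ?_⟩
  rw [Metric.mem_ball, dist_comm]
  exact (le_dynDist T dist hN x y).trans_lt hy

theorem exists_finite_small_cover [CompactSpace X] (hT : Continuous T) (N : ℕ) {ε : ℝ}
    (hε : 0 < ε) : ∃ (n : ℕ) (U : Fin n → Set X), (∀ i, IsOpen (U i)) ∧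
      (∀ i, ∀ x ∈ U i, ∀ y ∈ U i, dynDist T dist N x y ≤ ε) ∧ ⋃ i, U i = Set.univ := by
  let V : X → Set X := fun x => {y | ∀ n < N, dist (T^[n] x) (T^[n] y) < ε / 2}
  have hV : ∀ x, IsOpen (V x) := fun x => isOpen_dynBall hT N x _
  obtain ⟨t, ht⟩ := isCompact_univ.elim_finite_subcover V hV fun x _ =>
    Set.mem_iUnion.2 ⟨x, fun n _ => by rw [dist_self]; positivity⟩
  refine ⟨t.card, fun i => V (t.equivFin.symm i), fun i => hV _, ?_, ?_⟩
  · intro i x hx y hy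
    refine dynDist_le hε.le fun n hn => ?_
    have h1 := dist_triangle_left (T^[n] x) (T^[n] y) (T^[n] (t.equivFin.symm i : X))
    linarith [hx n hn, hy n hn]
  · refine Set.eq_univ_of_univ_subset fun x hx => ?_
    obtain ⟨z, hz, hxz⟩ := Set.mem_iUnion₂.1 (ht hx)
    refine Set.mem_iUnion.2 ⟨t.equivFin ⟨z, hz⟩, ?_⟩
    rwa [Equiv.symm_apply_apply]

theorem covNum_spec [CompactSpace X] (hT : Continuous T) {N : ℕ} (hN : 0 < N) {ε : ℝ}
    (hε : 0 < ε) (E : Set X) : ∃ U : Fin (covNum (dynDist T dist N) ε E) → Set X,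
      (∀ i, ROpen (dynDist T dist N) (U i)) ∧
      (∀ i, setEDiam (dynDist T dist N) (U i) < ENNReal.ofReal ε) ∧ E ⊆ ⋃ i, U i := by
  refine Nat.sInf_mem (s := {n : ℕ | ∃ U : Fin n → Set X, (∀ i, ROpen (dynDist T dist N) (U i)) ∧
    (∀ i, setEDiam (dynDist T dist N) (U i) < ENNReal.ofReal ε) ∧ E ⊆ ⋃ i, U i}) ?_
  obtain ⟨n, U, hU, hUd, hUc⟩ := exists_finite_small_cover hT N (half_pos hε)
  exact ⟨n, U, fun i => (hU i).rOpen_dynDist hN,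
    fun i => setEDiam_lt hε (half_lt_self hε) (hUd i), hUc ▸ Set.subset_univ _⟩

theorem covNum_mono [CompactSpace X] (hT : Continuous T) {N : ℕ} (hN : 0 < N) {ε : ℝ}
    (hε : 0 < ε) {E F : Set X} (h : E ⊆ F) :
    covNum (dynDist T dist N) ε E ≤ covNum (dynDist T dist N) ε F := by
  obtain ⟨U, hU, hUd, hUc⟩ := covNum_spec hT hN hε F
  exact Nat.sInf_le ⟨U, hU, hUd, h.trans hUc⟩

theorem supLogCov_nonneg {X Y : Type*} (π : X → Y) (ρ : X → X → ℝ) (ε : ℝ) :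
    0 ≤ supLogCov π ρ ε :=
  Real.iSup_nonneg fun _ => Real.log_natCast_nonneg _

theorem covNum_fiber_le_exp [CompactSpace X] (hT : Continuous T) {N : ℕ} (hN : 0 < N) {ε : ℝ}
    (hε : 0 < ε) {Y : Type*} (π : X → Y) (y : Y) :
    (covNum (dynDist T dist N) ε (π ⁻¹' {y}) : ℝ) ≤
      Real.exp (supLogCov π (dynDist T dist N) ε) := by
  rcases Nat.eq_zero_or_pos (covNum (dynDist T dist N) ε (π ⁻¹' {y})) with h0 | h0
  · rw [h0, Nat.cast_zero]
    exact (Real.exp_pos _).le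
  · rw [← Real.log_le_iff_le_exp (by exact_mod_cast h0)]
    refine le_ciSup (f := fun y => Real.log (covNum (dynDist T dist N) ε (π ⁻¹' {y}) : ℝ)) ?_ y
    refine ⟨Real.log (covNum (dynDist T dist N) ε Set.univ : ℝ), ?_⟩
    rintro _ ⟨y', rfl⟩
    rcases Nat.eq_zero_or_pos (covNum (dynDist T dist N) ε (π ⁻¹' {y'})) with h1 | h1
    · simp only [h1, Nat.cast_zero, Real.log_zero]
      exact Real.log_natCast_nonneg _
    · refine Real.log_le_log (by exact_mod_cast h1) ?_
      exact_mod_cast covNum_mono hT hN hε (Set.subset_univ _)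

/-- Preimages of uniformly small balls split into few pieces of small dynamical diameter. -/
theorem exists_uniform_labelling {Y : Type*} [CompactSpace X] [MetricSpace Y] [CompactSpace Y]
    (hT : Continuous T) {π : X → Y} (hπ : Continuous π) {N : ℕ} (hN : 0 < N) {ε : ℝ}
    (hε : 0 < ε) {A : ℕ} (hA : 1 ≤ A)
    (hcov : ∀ y, covNum (dynDist T dist N) ε (π ⁻¹' {y}) ≤ A) :
    ∃ δ > 0, ∀ y, ∃ lab : X → Fin A, ∀ x x', dist (π x) y < δ → dist (π x') y < δ →
      lab x = lab x' → dynDist T dist N x x' < ε := by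
  have hU := fun y => covNum_spec hT hN hε (π ⁻¹' {y})
  choose U hUo hUd hUc using hU
  let V : Y → Set Y := fun y => (π '' (⋃ i, U y i)ᶜ)ᶜ
  have hV : ∀ y, IsOpen (V y) := fun y =>
    ((isOpen_iUnion fun i => (hUo y i).isOpen hT).isClosed_compl.isCompact.image
      hπ).isClosed.isOpen_compl
  have hyV : ∀ y, y ∈ V y := by
    rintro y ⟨x, hx, hxy⟩
    exact hx (hUc y hxy)
  have hVU : ∀ y x, π x ∈ V y → ∃ i, x ∈ U y i := by
    intro y x hx
    by_contra hne
    exact hx ⟨x, fun hmem => hne (Set.mem_iUnion.1 hmem), rfl⟩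
  obtain ⟨δ, hδ, h⟩ := lebesgue_number_lemma_of_metric isCompact_univ hV
    fun y _ => Set.mem_iUnion.2 ⟨y, hyV y⟩
  refine ⟨δ, hδ, fun y => ?_⟩
  obtain ⟨y', hy'⟩ := h y (Set.mem_univ y)
  classical
  refine ⟨fun x => if hx : π x ∈ V y' then Fin.castLE (hcov y') (hVU y' x hx).choose
    else ⟨0, hA⟩, fun x x' hx hx' heq => ?_⟩
  have h1 : π x ∈ V y' := hy' hx
  have h2 : π x' ∈ V y' := hy' hx'
  simp only [dif_pos h1, dif_pos h2, Fin.castLE_inj] at heq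
  have h3 := (hVU y' x h1).choose_spec
  rw [heq] at h3
  exact lt_of_setEDiam_lt (hUd y' _) h3 (hVU y' x' h2).choose_spec

/-- Sets whose image orbits stay close split into few pieces of small dynamical diameter. -/
theorem exists_orbit_labelling {Y : Type*} [PseudoMetricSpace Y] {S : Y → Y} {π : X → Y}
    (hπ : ∀ n x, π (T^[n] x) = S^[n] (π x)) {N : ℕ} (hN : 0 < N) {ε δ : ℝ} (hε : 0 < ε) {A : ℕ}
    (hlab : ∀ y, ∃ lab : X → Fin A, ∀ x x', dist (π x) y < δ → dist (π x') y < δ →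
      lab x = lab x' → dynDist T dist N x x' < ε) {Q : ℕ} (e : X) :
    ∃ lab : X → (Fin ⌈(Q : ℝ) / N⌉₊ → Fin A), ∀ x x',
      (∀ n < Q, dist (S^[n] (π x)) (S^[n] (π e)) < δ) →
      (∀ n < Q, dist (S^[n] (π x')) (S^[n] (π e)) < δ) →
      lab x = lab x' → dynDist T dist Q x x' < ε := by
  have hN' : (0 : ℝ) < N := by exact_mod_cast hN
  choose lab hlab using hlab
  refine ⟨fun x j => lab (S^[j * N] (π e)) (T^[j * N] x), fun x x' hx hx' heq =>
    dynDist_lt hε fun n hn => ?_⟩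
  have hj : n / N < ⌈(Q : ℝ) / N⌉₊ := by
    rw [Nat.lt_ceil]
    refine Nat.cast_div_le.trans_lt ?_
    gcongr
  have hjn : n / N * N ≤ n := Nat.div_mul_le_self n N
  have h1 := hlab (S^[n / N * N] (π e)) (T^[n / N * N] x) (T^[n / N * N] x')
    (by rw [hπ]; exact hx _ (by omega)) (by rw [hπ]; exact hx' _ (by omega))
    (congr_fun heq ⟨n / N, hj⟩)
  have h2 := (le_dynDist T dist (Nat.mod_lt n hN) (T^[n / N * N] x) (T^[n / N * N] x')).trans_lt h1
  rwa [← Function.iterate_add_apply, ← Function.iterate_add_apply, Nat.mod_add_div'] at h2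

theorem exists_finset_of_labelling {α Λ : Type*} [PseudoMetricSpace α] [Nonempty α] [Fintype Λ]
    {E : Set α} {ε : ℝ} (lab : α → Λ) (h : ∀ x ∈ E, ∀ x' ∈ E, lab x = lab x' → dist x x' < ε) :
    ∃ B : Finset α, B.card ≤ Fintype.card Λ ∧ ∀ x ∈ E, ∃ b ∈ B, dist x b < ε := by
  classical
  refine ⟨Finset.univ.image fun l => if hl : ∃ x ∈ E, lab x = l then hl.choose
    else Classical.arbitrary α,
    Finset.card_image_le, fun x hx => ?_⟩
  have hl : ∃ x' ∈ E, lab x' = lab x := ⟨x, hx, rfl⟩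
  refine ⟨_, Finset.mem_image_of_mem _ (Finset.mem_univ (lab x)), ?_⟩
  rw [dif_pos hl]
  exact h x hx _ hl.choose_spec.1 hl.choose_spec.2.symm

theorem exists_simplicialComplex_stdSimplex (m : ℕ) :
    ∃ K : Geometry.SimplicialComplex ℝ (Fin m → ℝ), K.faces.Finite ∧
      (∀ s ∈ K.faces, s.card ≤ m + 1) ∧ stdSimplex ℝ (Fin m) ⊆ K.space := by
  classical
  let V : Finset (Fin m → ℝ) := Finset.univ.image fun i => Pi.single i 1
  let P : PreAbstractSimplicialComplex (Fin m → ℝ) :=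
    { faces := {s | s ⊆ V ∧ s.Nonempty}
      isRelLowerSet_faces := fun s hs => ⟨hs.2, fun t hts ht => ⟨hts.trans hs.1, ht⟩⟩ }
  have hind : AffineIndependent ℝ (Subtype.val : (⋃ s ∈ P.faces, (s : Set (Fin m → ℝ))) → _) := by
    refine (Pi.linearIndependent_single_one (Fin m) ℝ).affineIndependent.range.mono ?_
    refine Set.iUnion₂_subset fun s hs x hx => ?_
    obtain ⟨i, _, hi⟩ := Finset.mem_image.1 (hs.1 hx)
    exact ⟨i, hi⟩
  refine ⟨.ofAffineIndependent P hind, ?_, ?_, ?_⟩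
  · exact V.powerset.finite_toSet.subset fun s hs => by simpa using hs.1
  · intro s hs
    refine (Finset.card_le_card hs.1).trans (Finset.card_image_le.trans ?_)
    simp
  · intro x hx
    rw [← convexHull_rangle_single_eq_stdSimplex] at hx
    have hV : Set.range (fun i : Fin m => (Pi.single i 1 : Fin m → ℝ)) = V := by
      simp [V]
    rw [hV] at hx
    refine Geometry.SimplicialComplex.mem_space_iff.2 ⟨V, ⟨subset_rfl, ?_⟩, hx⟩
    exact_mod_cast convexHull_nonempty_iff.1 ⟨x, hx⟩

end DynamicalMetric

section Widim

variable {Y : Type*} [MetricSpace Y] [CompactSpace Y] {S : Y → Y}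

theorem widim_spec (hS : Continuous S) (N : ℕ) {ε : ℝ} (hε : 0 < ε) :
    ∃ (m : ℕ) (K : Geometry.SimplicialComplex ℝ (Fin m → ℝ)),
    K.faces.Finite ∧ (∀ s ∈ K.faces, s.card ≤ widim Y (dynDist S dist N) ε + 1) ∧
    ∃ f : Y → K.space, Continuous f ∧ ∀ y y', f y = f y' → dynDist S dist N y y' < ε := by
  have hne : {k : ℕ | ∃ (m : ℕ) (K : Geometry.SimplicialComplex ℝ (Fin m → ℝ)),
      K.faces.Finite ∧ (∀ s ∈ K.faces, s.card ≤ k + 1) ∧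
      ∃ f : Y → K.space, Continuous f ∧
        ∀ p : K.space, setEDiam (dynDist S dist N) (f ⁻¹' {p}) < ENNReal.ofReal ε}.Nonempty := by
    obtain ⟨m, U, hU, hUd, hUc⟩ := exists_finite_small_cover hS N (half_pos hε)
    obtain ⟨K, hK, hKc, hKs⟩ := exists_simplicialComplex_stdSimplex m
    obtain ⟨Λ, hΛ⟩ := PartitionOfUnity.exists_isSubordinate isClosed_univ U hU hUc.ge
    have hΛ1 : ∀ y, ∑ i, Λ i y = 1 := fun y => by
      rw [← finsum_eq_sum_of_fintype]
      exact Λ.sum_eq_one (Set.mem_univ y)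
    refine ⟨m, m, K, hK, hKc, fun y => ⟨fun i => Λ i y, hKs ⟨fun i => Λ.nonneg i y, hΛ1 y⟩⟩,
      by fun_prop, fun p => setEDiam_lt hε (half_lt_self hε) ?_⟩
    rintro y rfl y' hy'
    have heq : ∀ i, Λ i y' = Λ i y := fun i =>
      congr_fun (congr_arg Subtype.val (Set.mem_singleton_iff.1 hy')) i
    obtain ⟨i, hi⟩ : ∃ i, Λ i y ≠ 0 := by
      by_contra! h
      simpa [h] using hΛ1 y
    exact hUd i y (hΛ i (subset_tsupport _ hi)) y'
      (hΛ i (subset_tsupport _ (by rwa [Function.mem_support, heq])))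
  obtain ⟨m, K, hK, hKc, f, hf, hfd⟩ := Nat.sInf_mem hne
  exact ⟨m, K, hK, hKc, f, hf, fun y y' h =>
    lt_of_setEDiam_lt (hfd (f y')) h rfl⟩

end Widim

section MeanDimension

theorem dist_le_cubeDist {a : ℕ} (x y : Cube a) : dist x y ≤ cubeDist x y :=
  (dist_pi_le_iff (norm_nonneg _)).2 fun i =>
    norm_le_pi_norm ((fun i => (x i : ℝ)) - fun i => (y i : ℝ)) i

theorem mdim_nonneg (Y : Type*) [TopologicalSpace Y] (S : Y → Y) (d : Y → Y → ℝ) :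
    0 ≤ mdim Y S d := by
  refine le_limsup_of_frequently_le (Eventually.frequently (.of_forall fun ε => ?_))
  refine le_liminf_of_le (by isBoundedDefault) (.of_forall fun N => ?_)
  exact_mod_cast div_nonneg (Nat.cast_nonneg _) (Nat.cast_nonneg _)

/-- There are arbitrarily fine `δ`-embeddings of the orbit space of dimension `< m * b`. -/
theorem exists_widim_lt_of_mdim_lt {Y : Type*} [TopologicalSpace Y] {S : Y → Y} {d : Y → Y → ℝ}
    {m : ℝ} (hm : mdim Y S d < m) {δ : ℝ} (hδ : 0 < δ) :
    ∃ δ' > 0, δ' < δ ∧ ∃ b : ℕ, 0 < b ∧ (widim Y (dynDist S d b) δ' : ℝ) / b < m := by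
  obtain ⟨δ', hδ'm, hδ', hδδ'⟩ :=
    ((eventually_lt_of_limsup_lt hm).and (Ioo_mem_nhdsGT hδ)).exists
  obtain ⟨b, hbm, hb⟩ := ((frequently_lt_of_liminf_lt (by isBoundedDefault)
    hδ'm).and_eventually (eventually_gt_atTop 0)).exists
  exact ⟨δ', hδ', hδδ', b, hb, by exact_mod_cast hbm⟩

theorem sub_mul_log_le_of_exists_waist_bound {C : ℝ} (hC : 1 ≤ C)
    (hwaist : ∀ {Z : Type} [TopologicalSpace Z] [CompactSpace Z] [T2Space Z] {M k : ℕ},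
      GenericAvoidance Z k → ∀ {ε : ℝ}, 0 < ε → 2 * ε ^ 2 ≤ 1 →
      ∀ {f : (Fin M → unitInterval) → Z}, Continuous f → ∀ {A : ℕ}, 1 ≤ A →
      (∀ p, ∃ B : Finset (Fin M → unitInterval), B.card ≤ A ∧
        ∀ x, f x = p → ∃ b ∈ B, dist x b < ε) →
      (1 / ε) ^ (M - k) ≤ A * C ^ M)
    {s : ℝ} {X : Type*} [PseudoMetricSpace X] [CompactSpace X] {T : X → X} (hT : Continuous T)
    {N M : ℕ → ℕ} {ψ : ∀ n, Cube (M n) → X} (hψ : ∀ n, Continuous (ψ n))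
    (hN : Tendsto N atTop atTop)
    (hMN : Tendsto (fun n => (M n : ℝ) / (N n : ℝ)) atTop (𝓝 s))
    (hexp : ∀ (n : ℕ) (x y : Cube (M n)), cubeDist x y ≤ dynDist T dist (N n) (ψ n x) (ψ n y))
    {Y : Type*} [MetricSpace Y] [CompactSpace Y] {S : Y → Y} (hS : Continuous S)
    {π : X → Y} (hπ : Continuous π) (hequiv : ∀ n x, π (T^[n] x) = S^[n] (π x))
    {ε : ℝ} (hε : 0 < ε) (hε2 : 2 * ε ^ 2 ≤ 1) {N₀ : ℕ} (hN₀ : 0 < N₀)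
    {m : ℝ} (hm : mdim Y S dist < m) :
    (s - m) * Real.log (1 / ε) ≤ supLogCov π (dynDist T dist N₀) ε / N₀ + s * Real.log C := by
  set a := supLogCov π (dynDist T dist N₀) ε with ha
  set A := ⌊Real.exp a⌋₊ with hAdef
  have ha0 : 0 ≤ a := supLogCov_nonneg _ _ _
  have hA : 1 ≤ A := Nat.le_floor (by simpa using ha0)
  have hAa : Real.log A ≤ a := by
    rw [Real.log_le_iff_le_exp (by exact_mod_cast hA)]
    exact Nat.floor_le (Real.exp_pos a).le
  have hε1 : ε ≤ 1 := by nlinarith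
  have hℓ : 0 ≤ Real.log (1 / ε) := Real.log_nonneg ((one_le_div hε).2 hε1)
  obtain ⟨δ, hδ, hlab⟩ := exists_uniform_labelling hT hπ hN₀ hε hA
    fun y => Nat.le_floor (covNum_fiber_le_exp hT hN₀ hε π y)
  obtain ⟨δ', hδ', hδδ', b, hb, hbm⟩ := exists_widim_lt_of_mdim_lt hm hδ
  obtain ⟨r, K, hK, hKc, g, hg, hgd⟩ := widim_spec hS b hδ'
  set k := widim Y (dynDist S dist b) δ' with hk
  have hb' : (0 : ℝ) < b := by exact_mod_cast hb
  have hN₀' : (0 : ℝ) < N₀ := by exact_mod_cast hN₀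
  have := isCompact_iff_compactSpace.1 (isCompact_space hK)
  have hmain : ∀ n, (M n - (N n / b + 1) * k) * Real.log (1 / ε) ≤
      (N n / N₀ + 1) * a + M n * Real.log C := by
    intro n
    set L := ⌈(N n : ℝ) / b⌉₊ with hL
    set q := ⌈(N n : ℝ) / N₀⌉₊ with hq
    let f : Cube (M n) → Fin L → K.space := fun x l => g (π (T^[l * b] (ψ n x)))
    have hf : Continuous f := continuous_pi fun l =>
      hg.comp (hπ.comp ((hT.iterate _).comp (hψ n)))
    have hfiber : ∀ x x', f x = f x' →
        ∀ i < N n, dist (S^[i] (π (ψ n x))) (S^[i] (π (ψ n x'))) < δ := by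
      intro x x' hxx' i hi
      have hl : i / b < L := by
        rw [hL, Nat.lt_ceil]
        refine Nat.cast_div_le.trans_lt ?_
        gcongr
      have h1 := hgd _ _ (congr_fun hxx' ⟨i / b, hl⟩)
      have h2 := ((le_dynDist S dist (Nat.mod_lt i hb) _ _).trans_lt h1).trans hδδ'
      rwa [hequiv, hequiv, ← Function.iterate_add_apply, ← Function.iterate_add_apply,
        Nat.mod_add_div'] at h2
    have hcover : ∀ p, ∃ B : Finset (Cube (M n)), B.card ≤ A ^ q ∧
        ∀ x, f x = p → ∃ b ∈ B, dist x b < ε := by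
      intro p
      by_cases hp : ∃ x₀, f x₀ = p
      · obtain ⟨x₀, rfl⟩ := hp
        obtain ⟨lab, h⟩ := exists_orbit_labelling hequiv hN₀ hε hlab (Q := N n) (ψ n x₀)
        obtain ⟨B, hBA, hB⟩ := exists_finset_of_labelling (E := f ⁻¹' {f x₀}) (ε := ε)
          (fun x => lab (ψ n x)) fun x hx x' hx' heq =>
            ((dist_le_cubeDist x x').trans (hexp n x x')).trans_lt
              (h _ _ (hfiber _ _ hx) (hfiber _ _ hx') heq)
        exact ⟨B, by simpa using hBA, hB⟩
      · exact ⟨∅, by simp, fun x hx => (hp ⟨x, hx⟩).elim⟩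
    have h1 := hwaist (GenericAvoidance.pi_space (L := L) hK hKc) hε hε2 hf
      (Nat.one_le_pow _ _ hA) hcover
    have h2 := Real.log_le_log (by positivity) h1
    have hApos : (A : ℝ) ≠ 0 := by positivity
    rw [Nat.cast_pow, Real.log_mul (by positivity) (by positivity), Real.log_pow, Real.log_pow,
      Real.log_pow] at h2
    have h3 : (M n : ℝ) ≤ (M n - L * k : ℕ) + L * k := by
      exact_mod_cast le_tsub_add
    have hL1 : (L : ℝ) ≤ N n / b + 1 := (Nat.ceil_lt_add_one (by positivity)).le
    have hq1 : (q : ℝ) ≤ N n / N₀ + 1 := (Nat.ceil_lt_add_one (by positivity)).le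
    calc _ ≤ (M n - L * k : ℕ) * Real.log (1 / ε) := by
          gcongr
          have : (L : ℝ) * k ≤ (N n / b + 1) * k := by gcongr
          linarith
      _ ≤ q * Real.log A + M n * Real.log C := h2
      _ ≤ _ := by gcongr
  have hN1 : Tendsto (fun n => ((N n : ℝ))⁻¹) atTop (𝓝 0) :=
    tendsto_inv_atTop_zero.comp (tendsto_natCast_atTop_atTop.comp hN)
  have hlim1 : Tendsto (fun n => ((M n : ℝ) / N n - (1 / b + (N n : ℝ)⁻¹) * k) *
      Real.log (1 / ε)) atTop (𝓝 ((s - (1 / b + 0) * k) * Real.log (1 / ε))) :=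
    (hMN.sub ((hN1.const_add _).mul_const _)).mul_const _
  have hlim2 : Tendsto (fun n => (1 / N₀ + (N n : ℝ)⁻¹) * a + (M n : ℝ) / N n * Real.log C)
      atTop (𝓝 ((1 / N₀ + 0) * a + s * Real.log C)) :=
    ((hN1.const_add _).mul_const _).add (hMN.mul_const _)
  have hlim := le_of_tendsto_of_tendsto hlim1 hlim2 <| by
    filter_upwards [hN.eventually_gt_atTop 0] with n hn
    have hn' : (0 : ℝ) < N n := by exact_mod_cast hn
    calc _ = (M n - (N n / b + 1) * k) * Real.log (1 / ε) / N n := by field_simp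
      _ ≤ ((N n / N₀ + 1) * a + M n * Real.log C) / N n := by
        gcongr
        exact hmain n
      _ = _ := by field_simp
  calc (s - m) * Real.log (1 / ε) ≤ (s - (1 / b + 0) * k) * Real.log (1 / ε) := by
        gcongr
        rw [add_zero, one_div_mul_eq_div]
        exact hbm.le
    _ ≤ _ := hlim
    _ = _ := by ring

end MeanDimension

/-- main technical theorem, conclusion (3): under the hypotheses of the main
technical theorem, every equivariant continuous map `π : (X, T) → (Y, S)`
satisfies `lower-mdim_M(π, T, d) ≥ s − 2·mdim(Y, S)`. -/
theorem stmt_17 (s : ℝ) (hs : 0 ≤ s) (X : Type) [MetricSpace X] [CompactSpace X]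
    (T : X ≃ₜ X) (N M : ℕ → ℕ)
    (ψ : ∀ n, Cube (M n) → X) (hψcont : ∀ n, Continuous (ψ n))
    (hN : Filter.Tendsto N Filter.atTop Filter.atTop)
    (hMN : Filter.Tendsto (fun n => (M n : ℝ) / (N n : ℝ)) Filter.atTop (𝓝 s))
    (hexp : ∀ (n : ℕ) (x y : Cube (M n)),
      cubeDist x y ≤ dynDist (⇑T) dist (N n) (ψ n x) (ψ n y))
    (Y : Type) [MetricSpace Y] [CompactSpace Y] (S : Y ≃ₜ Y)
    (π : X → Y) (hcont : Continuous π) (hequiv : ∀ x, π (T x) = S (π x)) :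
    (s : EReal) - 2 * mdim Y (⇑S) dist ≤ lowerCondMdimM π (⇑T) dist := by
  obtain ⟨C, hC, hwaist⟩ := exists_waist_bound
  have hequiv' : ∀ n x, π (T^[n] x) = S^[n] (π x) := fun n =>
    (Function.Semiconj.iterate_right (f := π) (ga := T) (gb := S) hequiv n)
  have hD0 := mdim_nonneg Y S dist
  induction hD : mdim Y S dist with
  | bot => simp [hD] at hD0
  | top => simp [EReal.mul_top_of_pos]
  | coe D =>
    rw [hD] at hD0
    have hD0' : 0 ≤ D := by exact_mod_cast hD0
    refine EReal.ge_of_forall_gt_iff_ge.1 fun c hc => ?_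
    have hc' : c < s - 2 * D := by
      rw [show (2 : EReal) = ((2 : ℝ) : EReal) from rfl] at hc
      exact_mod_cast hc
    set η := s - D - c with hη
    have hη0 : 0 < η := by linarith
    have hlog : Tendsto (fun ε : ℝ => Real.log (1 / ε)) (𝓝[>] 0) atTop := by
      simp only [one_div]
      exact Real.tendsto_log_atTop.comp tendsto_inv_nhdsGT_zero
    refine le_liminf_of_le (by isBoundedDefault) ?_
    filter_upwards [Ioo_mem_nhdsGT (show (0 : ℝ) < 1 / 2 by norm_num),
      hlog.eventually_gt_atTop 0, hlog.eventually_ge_atTop (s * Real.log C / (η / 2))]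
      with ε hε hℓ hℓη
    refine le_liminf_of_le (by isBoundedDefault) ?_
    filter_upwards [eventually_gt_atTop 0] with N₀ hN₀
    have hN₀' : (0 : ℝ) < N₀ := by exact_mod_cast hN₀
    have h1 := sub_mul_log_le_of_exists_waist_bound hC hwaist T.continuous hψcont hN hMN hexp
      S.continuous hcont hequiv' hε.1 (by nlinarith [hε.1, hε.2]) hN₀ (m := D + η / 2)
      (by rw [hD]; exact_mod_cast (by linarith : D < D + η / 2))
    rw [div_le_iff₀ (by positivity)] at hℓη
    rw [EReal.coe_le_coe_iff, ← div_div, le_div_iff₀ hℓ]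
    nlinarith
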